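/- Let n ≥ 1, let μ = (m, n−m) ⊢ n be a two-part partition, and let R, S, T be multisets of positive integers with |R| + |S| + |T| = n, |R| ≤ m and |S| > m. Let 𝒮 be the set of all pairs (U, V) of multisets such that S = U ⊔ V and |U| = m − |R|, and for (U, V) ∈ 𝒮 let A[U,V] be the row-standard μ-tableau whose first-row multiset is R ⊔ U and whose second-row multiset is T ⊔ V; every A[U,V] has the same type λ, where λ_i = R_i + S_i + T_i. Then ∑_{(U,V)∈𝒮} (∏_i [R_i+U_i choose R_i]_q [T_i+V_i choose T_i]_q) (∏_{i<j} q^{R_j U_i + T_i V_j}) φ̂_{A[U,V]} = 0 as a homomorphism S^μ → M^λ. -/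

import Mathlib

open scoped Classical

noncomputable section

namespace FayersSemistd

/-- The value at `q` of the Gaussian (quantum) binomial coefficient polynomial
`[a choose b]`, defined via the `q`-Pascal recurrence. -/
def qBinom {F : Type*} [Field F] (q : F) : ℕ → ℕ → F
  | _, 0 => 1
  | 0, _+1 => 0
  | a+1, b+1 => qBinom q a b + q ^ (b+1) * qBinom q a (b+1)

/-- `∏_i [A_i + B_i choose A_i]_q`, where `A_i`, `B_i` are multiplicities in the
multisets `A` and `B`. -/
def qBinomProd {F : Type*} [Field F] (q : F) (A B : Multiset ℕ) : F :=
  ∏ i ∈ (A + B).toFinset, qBinom q ((A + B).count i) (A.count i)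

/-- `∑_{i<j} A_j * B_i` : the number of pairs `(x,y)` with `x ∈ A`, `y ∈ B`, `y < x`,
counted with multiplicity. -/
def invPairs (A B : Multiset ℕ) : ℕ :=
  ((A.product B).filter (fun p => p.2 < p.1)).card

/-- The Coxeter length of a permutation of `{0,…,n-1}`: its number of inversions. -/
def permLength {n : ℕ} (w : Equiv.Perm (Fin n)) : ℕ :=
  (Finset.univ.filter (fun p : Fin n × Fin n => p.1 < p.2 ∧ w p.2 < w p.1)).card

/-- `λ_0 + ⋯ + λ_{r-1}`. -/
def cumSum (lam : ℕ → ℕ) (r : ℕ) : ℕ := ∑ i ∈ Finset.range r, lam i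

/-- The (0-indexed) row of the diagram of `λ` containing the (0-indexed) position `p`,
when positions are listed row by row. -/
def rowOf (lam : ℕ → ℕ) (p : ℕ) : ℕ := sInf {r | p < cumSum lam (r+1)}

/-- `λ` is a composition of `n`: finitely many nonzero parts, summing to `n`. -/
def IsComposition (n : ℕ) (lam : ℕ → ℕ) : Prop :=
  ∃ N, (∀ r, N ≤ r → lam r = 0) ∧ cumSum lam N = n

/-- `μ` is a partition of `n`. -/
def IsPartition (n : ℕ) (mu : ℕ → ℕ) : Prop := IsComposition n mu ∧ Antitone mu

/-- The conjugate partition (0-indexed): `conjP μ i = #{r | μ r > i}`. -/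
def conjP (mu : ℕ → ℕ) (i : ℕ) : ℕ := sInf {r | mu r ≤ i}

/-- The standard Young subgroup `W_λ` of `S_n` (as a set): the permutations preserving
each consecutive block of sizes `λ_0, λ_1, …`. -/
def youngW {n : ℕ} (lam : ℕ → ℕ) : Set (Equiv.Perm (Fin n)) :=
  {w | ∀ p : Fin n, rowOf lam ((w p : Fin n) : ℕ) = rowOf lam (p : ℕ)}

/-- The adjacent transposition `(i, i+1)` (0-indexed) in `S_n`. -/
def adjT {n : ℕ} (i : ℕ) (h : i + 1 < n) : Equiv.Perm (Fin n) :=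
  Equiv.swap ⟨i, Nat.lt_of_succ_lt h⟩ ⟨i+1, h⟩

/-- `T : S_n → H` is the standard basis of an Iwahori–Hecke algebra of `S_n` over `F`
with parameter `q`.  Permutations act on the right, so the product `w·s` of the paper
is `s * w` in Mathlib's convention; the multiplication rule
`T_w T_s = T_{ws}` (length increasing) resp. `T_w T_s = q T_{ws} + (q-1) T_w`
(length decreasing) determines the algebra structure on the basis. -/
structure IsHeckeBasis {F : Type*} [Field F] {H : Type*} [Ring H] [Algebra F H] {n : ℕ}
    (q : F) (T : Equiv.Perm (Fin n) → H) : Prop where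
  li : LinearIndependent F T
  total : Submodule.span F (Set.range T) = ⊤
  one : T 1 = 1
  mul_adj_asc : ∀ (w : Equiv.Perm (Fin n)) (i : ℕ) (h : i + 1 < n),
    permLength w < permLength (adjT i h * w) →
    T w * T (adjT i h) = T (adjT i h * w)
  mul_adj_desc : ∀ (w : Equiv.Perm (Fin n)) (i : ℕ) (h : i + 1 < n),
    permLength (adjT i h * w) < permLength w →
    T w * T (adjT i h) = q • T (adjT i h * w) + (q - 1) • T w

variable {F : Type*} [Field F] {H : Type*} [Ring H] [Algebra F H] {n : ℕ}

/-- `x_λ = ∑_{w ∈ W_λ} T_w`. -/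
def xElt (T : Equiv.Perm (Fin n) → H) (lam : ℕ → ℕ) : H :=
  ∑ w ∈ Finset.univ.filter (· ∈ youngW lam), T w

/-- `y_λ = ∑_{w ∈ W_λ} (-q)^{-l(w)} T_w`. -/
def yElt (q : F) (T : Equiv.Perm (Fin n) → H) (lam : ℕ → ℕ) : H :=
  ∑ w ∈ Finset.univ.filter (· ∈ youngW lam), ((-q)⁻¹) ^ permLength w • T w

/-- The double coset `W_λ d W_μ` (paper convention: maps act on the right, so the
paper product `u·d·v` is `v * d * u` in Mathlib's convention). -/
def doubleCoset {n : ℕ} (lam mu : ℕ → ℕ) (d : Equiv.Perm (Fin n)) :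
    Set (Equiv.Perm (Fin n)) :=
  {w | ∃ u ∈ youngW (n := n) lam, ∃ v ∈ youngW (n := n) mu, w = v * d * u}

/-- `∑_{w ∈ W_λ 1_A W_μ} T_w`, the image `x_μ φ_A` of `x_μ` under the tableau
homomorphism `φ_A : M^μ → M^λ`, where `d = 1_A`. -/
def XPhi (T : Equiv.Perm (Fin n) → H) (lam mu : ℕ → ℕ) (d : Equiv.Perm (Fin n)) : H :=
  ∑ w ∈ Finset.univ.filter (· ∈ doubleCoset lam mu d), T w

/-- A row-standard tableau is recorded by the multisets of entries of its rows; it has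
shape `μ` when row `r` has `μ_r` entries. -/
def RowsOfShape (mu : ℕ → ℕ) (A : ℕ → Multiset ℕ) : Prop := ∀ r, (A r).card = mu r

/-- The tableau with rows `A 0, A 1, …` has type `λ` when the entry `v` occurs `λ_v`
times in total (entries and types are 0-indexed). -/
def HasType (A : ℕ → Multiset ℕ) (lam : ℕ → ℕ) : Prop :=
  ∀ v, (∑ᶠ r, (A r).count v) = lam v

/-- The entry in row `r`, column `c` (0-indexed) of the row-standard tableau with row
multisets `A`. -/
def entryAt (A : ℕ → Multiset ℕ) (r c : ℕ) : ℕ := ((A r).sort (· ≤ ·)).getD c 0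

/-- `d = 1_A` for the row-standard `μ`-tableau `A` of type `λ`: the tableau `t^λ d`
(whose entry at position `p` is `d p`) is row-standard (first clause), and the entry
`d p` lies in row `r` of `t^λ d` exactly when the position occupied by `d p` in `t^μ`
is occupied by `r` in `A` (second clause). -/
def Is1A {n : ℕ} (mu lam : ℕ → ℕ) (A : ℕ → Multiset ℕ) (d : Equiv.Perm (Fin n)) : Prop :=
  (∀ p p' : Fin n, rowOf lam (p : ℕ) = rowOf lam (p' : ℕ) → p < p' → d p < d p') ∧
  (∀ p : Fin n,
    entryAt A (rowOf mu ((d p : Fin n) : ℕ))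
      (((d p : Fin n) : ℕ) - cumSum mu (rowOf mu ((d p : Fin n) : ℕ)))
      = rowOf lam (p : ℕ))

/-- A row-standard tableau is semistandard if its columns are strictly increasing. -/
def Semistandard (mu : ℕ → ℕ) (A : ℕ → Multiset ℕ) : Prop :=
  ∀ r c, c < mu (r+1) → entryAt A r c < entryAt A (r+1) c

/-- The (0-indexed) column of the position `p` in the diagram of `μ`. -/
def colIdx (mu : ℕ → ℕ) (p : ℕ) : ℕ := p - cumSum mu (rowOf mu p)

/-- `w = w_μ`, i.e. `t^μ w = t_μ`: the image of position `p` is the number of positions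
coming strictly before `p` in the column-reading order of the diagram of `μ`. -/
def IsWmu {n : ℕ} (mu : ℕ → ℕ) (w : Equiv.Perm (Fin n)) : Prop :=
  ∀ p : Fin n, ((w p : Fin n) : ℕ) = (Finset.univ.filter (fun p' : Fin n =>
    colIdx mu (p' : ℕ) < colIdx mu (p : ℕ) ∨
      (colIdx mu (p' : ℕ) = colIdx mu (p : ℕ) ∧ rowOf mu (p' : ℕ) < rowOf mu (p : ℕ)))).card

def comp1 (a : ℕ) : ℕ → ℕ := fun r => if r = 0 then a else 0
def comp2 (a b : ℕ) : ℕ → ℕ := fun r => if r = 0 then a else if r = 1 then b else 0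
def comp3 (a b c : ℕ) : ℕ → ℕ :=
  fun r => if r = 0 then a else if r = 1 then b else if r = 2 then c else 0
def comp4 (a b c d : ℕ) : ℕ → ℕ :=
  fun r => if r = 0 then a else if r = 1 then b else if r = 2 then c else if r = 3 then d else 0
def rows1 (a : Multiset ℕ) : ℕ → Multiset ℕ := fun r => if r = 0 then a else 0
def rows2 (a b : Multiset ℕ) : ℕ → Multiset ℕ :=
  fun r => if r = 0 then a else if r = 1 then b else 0
def rows3 (a b c : Multiset ℕ) : ℕ → Multiset ℕ :=
  fun r => if r = 0 then a else if r = 1 then b else if r = 2 then c else 0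
def rows4 (a b c d : Multiset ℕ) : ℕ → Multiset ℕ :=
  fun r => if r = 0 then a else if r = 1 then b else if r = 2 then c else if r = 3 then d else 0

end FayersSemistd
namespace FayersSemistd

section HeckeAlgebra

variable {F : Type*} [Field F] {H : Type*} [Ring H] [Algebra F H] {n : ℕ}

theorem adjT_val (i : ℕ) (h : i + 1 < n) (x : Fin n) :
    ((adjT i h x : Fin n) : ℕ) =
      if (x : ℕ) = i then i + 1 else if (x : ℕ) = i + 1 then i else (x : ℕ) := by
  unfold adjT
  rw [Equiv.swap_apply_def]
  simp only [Fin.ext_iff]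
  split_ifs <;> simp_all

theorem adjT_mul_self (i : ℕ) (h : i + 1 < n) : adjT i h * adjT i h = 1 :=
  Equiv.swap_mul_self _ _

theorem adjT_inv (i : ℕ) (h : i + 1 < n) : (adjT i h)⁻¹ = adjT i h :=
  Equiv.swap_inv _ _

theorem adjT_mul_cancel (i : ℕ) (h : i + 1 < n) (w : Equiv.Perm (Fin n)) :
    adjT i h * (adjT i h * w) = w := by
  rw [← mul_assoc, adjT_mul_self, one_mul]

theorem adjT_adjT (i : ℕ) (h : i + 1 < n) (x : Fin n) : adjT i h (adjT i h x) = x := by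
  rw [← Equiv.Perm.mul_apply, adjT_mul_self, Equiv.Perm.one_apply]

theorem adjT_left (i : ℕ) (h : i + 1 < n) : adjT i h ⟨i, by omega⟩ = ⟨i + 1, h⟩ :=
  Equiv.swap_apply_left _ _

theorem adjT_right (i : ℕ) (h : i + 1 < n) : adjT i h ⟨i + 1, h⟩ = ⟨i, by omega⟩ :=
  Equiv.swap_apply_right _ _

/-- An adjacent transposition preserves the order of every pair other than the one it swaps. -/
theorem adjT_lt {i : ℕ} {h : i + 1 < n} {x y : Fin n} (hxy : x < y)
    (hne : ¬ ((x : ℕ) = i ∧ (y : ℕ) = i + 1)) : adjT i h x < adjT i h y := by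
  rw [Fin.lt_def] at *
  rw [adjT_val, adjT_val]
  split_ifs <;> omega

/-- `i` precedes `i + 1` in the one-line notation of the inverse of `w`, i.e. multiplying `w`
by the transposition of the values `i` and `i + 1` increases its length. -/
def Asc (w : Equiv.Perm (Fin n)) (i : ℕ) (h : i + 1 < n) : Prop :=
  w⁻¹ ⟨i, by omega⟩ < w⁻¹ ⟨i + 1, h⟩

theorem Asc.not_adjT_mul {w : Equiv.Perm (Fin n)} {i : ℕ} {h : i + 1 < n} (ha : Asc w i h) :
    ¬ Asc (adjT i h * w) i h := by
  unfold Asc at *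
  simp only [mul_inv_rev, adjT_inv, Equiv.Perm.mul_apply, adjT_left, adjT_right]
  exact not_lt.2 ha.le

theorem asc_adjT_mul {w : Equiv.Perm (Fin n)} {i : ℕ} {h : i + 1 < n} (ha : ¬ Asc w i h) :
    Asc (adjT i h * w) i h := by
  unfold Asc at *
  simp only [mul_inv_rev, adjT_inv, Equiv.Perm.mul_apply, adjT_left, adjT_right]
  refine lt_of_le_of_ne (not_lt.1 ha) fun he => ?_
  have := w⁻¹.injective he
  simp at this

theorem Asc.permLength {w : Equiv.Perm (Fin n)} {i : ℕ} {h : i + 1 < n} (ha : Asc w i h) :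
    permLength (adjT i h * w) = permLength w + 1 := by
  unfold FayersSemistd.permLength
  have hmem : (w⁻¹ ⟨i, by omega⟩, w⁻¹ ⟨i + 1, h⟩) ∉
      Finset.univ.filter (fun p : Fin n × Fin n => p.1 < p.2 ∧ w p.2 < w p.1) := by
    simp
  rw [← Finset.card_insert_of_notMem hmem]
  congr 1
  ext ⟨a, b⟩
  rw [Finset.mem_filter, Finset.mem_insert, Finset.mem_filter]
  simp only [Finset.mem_univ, true_and, Prod.mk.injEq, Equiv.Perm.mul_apply]
  constructor
  · rintro ⟨hab, hlt⟩
    by_cases hc : (w a : ℕ) = i ∧ (w b : ℕ) = i + 1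
    · left
      constructor
      · rw [Equiv.Perm.eq_inv_iff_eq]; exact Fin.ext hc.1
      · rw [Equiv.Perm.eq_inv_iff_eq]; exact Fin.ext hc.2
    · right
      refine ⟨hab, ?_⟩
      by_contra hn
      have hne : w a ≠ w b := fun he => hab.ne (w.injective he)
      exact absurd (adjT_lt (h := h) (lt_of_le_of_ne (not_lt.1 hn) hne) hc) hlt.not_gt
  · rintro (⟨rfl, rfl⟩ | ⟨hab, hlt⟩)
    · refine ⟨ha, ?_⟩
      simp [adjT_left, adjT_right]
    · refine ⟨hab, adjT_lt hlt ?_⟩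
      rintro ⟨h1, h2⟩
      have e1 : b = w⁻¹ ⟨i, by omega⟩ := by
        rw [Equiv.Perm.eq_inv_iff_eq]; exact Fin.ext h1
      have e2 : a = w⁻¹ ⟨i + 1, h⟩ := by
        rw [Equiv.Perm.eq_inv_iff_eq]; exact Fin.ext h2
      unfold Asc at ha
      rw [← e1, ← e2] at ha
      exact ha.not_gt hab

theorem permLength_adjT_mul_lt {w : Equiv.Perm (Fin n)} {i : ℕ} {h : i + 1 < n}
    (ha : ¬ Asc w i h) : permLength w = permLength (adjT i h * w) + 1 := by
  have := (asc_adjT_mul ha).permLength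
  rwa [adjT_mul_cancel] at this

theorem permLength_inv (w : Equiv.Perm (Fin n)) : permLength w⁻¹ = permLength w := by
  unfold permLength
  refine Finset.card_nbij' (fun p => (w⁻¹ p.2, w⁻¹ p.1)) (fun p => (w p.2, w p.1)) ?_ ?_ ?_ ?_
  · rintro ⟨a, b⟩
    simp +contextual
  · rintro ⟨a, b⟩
    simp +contextual
  · rintro ⟨a, b⟩ _
    simp
  · rintro ⟨a, b⟩ _
    simp

theorem permLength_one : permLength (1 : Equiv.Perm (Fin n)) = 0 := by
  unfold permLength
  rw [Finset.card_eq_zero, Finset.filter_eq_empty_iff]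
  rintro ⟨a, b⟩ _ ⟨h1, h2⟩
  exact h1.not_gt h2

/-- A function on `Fin n` is strictly increasing between two points if it increases at each step
in between. -/
theorem lt_of_forall_adj {α : Type*} [Preorder α] (f : Fin n → α) {a b : Fin n} (hab : a < b)
    (hf : ∀ (i : ℕ) (h : i + 1 < n), (a : ℕ) ≤ i → i + 1 ≤ (b : ℕ) →
      f ⟨i, by omega⟩ < f ⟨i + 1, h⟩) : f a < f b := by
  obtain ⟨a, ha⟩ := a
  obtain ⟨b, hb⟩ := b
  simp only [Fin.mk_lt_mk] at hab hf ⊢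
  induction b, hab using Nat.le_induction with
  | base => exact hf a hb le_rfl le_rfl
  | succ b hab ih =>
    exact (ih (by omega) fun i h h1 h2 => hf i h h1 (by omega)).trans
      (hf b hb (by omega) le_rfl)

theorem eq_one_of_forall_asc {w : Equiv.Perm (Fin n)} (hw : ∀ i h, Asc w i h) : w = 1 := by
  have hm : StrictMono (w⁻¹ : Equiv.Perm (Fin n)) :=
    fun a b hab => lt_of_forall_adj _ hab fun i h _ _ => hw i h
  have : (w⁻¹ : Equiv.Perm (Fin n)) = 1 := by
    ext x
    have := congrFun (hm.range_inj (g := id) strictMono_id |>.1 (by simp)) x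
    simp [this]
  exact inv_eq_one.1 this

/-- Induction on the length of a permutation. -/
theorem perm_length_induction {P : Equiv.Perm (Fin n) → Prop} (one : P 1)
    (step : ∀ w i h, Asc w i h → P w → P (adjT i h * w)) (w : Equiv.Perm (Fin n)) : P w := by
  induction hl : permLength w using Nat.strong_induction_on generalizing w with
  | _ l ih =>
    by_cases hw : ∀ i h, Asc w i h
    · rwa [eq_one_of_forall_asc hw]
    · push Not at hw
      obtain ⟨i, h, hi⟩ := hw
      have := step _ i h (asc_adjT_mul hi)
        (ih _ (by have := permLength_adjT_mul_lt hi; omega) _ rfl)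
      rwa [adjT_mul_cancel] at this

theorem adjT_mul_eq_iff {i : ℕ} {h : i + 1 < n} {v w : Equiv.Perm (Fin n)} :
    adjT i h * v = w ↔ v = adjT i h * w := by
  constructor
  · rintro rfl; rw [adjT_mul_cancel]
  · rintro rfl; rw [adjT_mul_cancel]

namespace IsHeckeBasis

variable {q : F} {T : Equiv.Perm (Fin n) → H}

theorem mul_asc (hT : IsHeckeBasis q T) {w : Equiv.Perm (Fin n)} {i : ℕ} {h : i + 1 < n}
    (ha : Asc w i h) : T w * T (adjT i h) = T (adjT i h * w) :=
  hT.mul_adj_asc w i h (by rw [ha.permLength]; omega)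

theorem mul_desc (hT : IsHeckeBasis q T) {w : Equiv.Perm (Fin n)} {i : ℕ} {h : i + 1 < n}
    (ha : ¬ Asc w i h) : T w * T (adjT i h) = q • T (adjT i h * w) + (q - 1) • T w :=
  hT.mul_adj_desc w i h (by rw [permLength_adjT_mul_lt ha]; omega)

/-- The coordinates of an element of the Hecke algebra in the basis `T`. -/
def coef (hT : IsHeckeBasis q T) (w : Equiv.Perm (Fin n)) : H →ₗ[F] F :=
  (Module.Basis.mk hT.li hT.total.ge).coord w

theorem coef_T (hT : IsHeckeBasis q T) (v w : Equiv.Perm (Fin n)) :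
    hT.coef w (T v) = if v = w then 1 else 0 := by
  have : T v = Module.Basis.mk hT.li hT.total.ge v := by simp
  rw [coef, this, Module.Basis.coord_apply, Module.Basis.repr_self, Finsupp.single_apply]

theorem ext_coef (hT : IsHeckeBasis q T) {x y : H} (h : ∀ w, hT.coef w x = hT.coef w y) :
    x = y :=
  (Module.Basis.mk hT.li hT.total.ge).ext_elem h

theorem T_induction (hT : IsHeckeBasis q T) {P : H → Prop} (basis : ∀ w, P (T w))
    (zero : P 0) (add : ∀ x y, P x → P y → P (x + y)) (smul : ∀ (c : F) x, P x → P (c • x))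
    (x : H) : P x := by
  have hx : x ∈ Submodule.span F (Set.range T) := by rw [hT.total]; trivial
  induction hx using Submodule.span_induction with
  | mem x hx => obtain ⟨w, rfl⟩ := hx; exact basis w
  | zero => exact zero
  | add x y _ _ hx hy => exact add x y hx hy
  | smul c x _ hx => exact smul c x hx

theorem coef_mul_adj (hT : IsHeckeBasis q T) (x : H) (w : Equiv.Perm (Fin n)) (i : ℕ)
    (h : i + 1 < n) :
    hT.coef w (x * T (adjT i h)) =
      if Asc w i h then q * hT.coef (adjT i h * w) x
      else hT.coef (adjT i h * w) x + (q - 1) * hT.coef w x := by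
  induction x using hT.T_induction with
  | basis v =>
    by_cases hv : Asc v i h
    · have h1 : v = w → Asc w i h := by rintro rfl; exact hv
      have h2 : v = adjT i h * w → ¬ Asc w i h := by
        rintro rfl hw; exact hw.not_adjT_mul hv
      rw [hT.mul_asc hv]
      simp only [coef_T, adjT_mul_eq_iff]
      split_ifs <;> simp_all
    · have h1 : v = w → ¬ Asc w i h := by rintro rfl; exact hv
      have h2 : v = adjT i h * w → Asc w i h := by
        rintro rfl; by_contra hw; exact hv (asc_adjT_mul hw)
      rw [hT.mul_desc hv]
      simp only [coef_T, adjT_mul_eq_iff, map_add, map_smul, smul_eq_mul]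
      split_ifs <;> simp_all
  | zero => simp
  | add x y hx hy => rw [add_mul, map_add, hx, hy]; split_ifs <;> simp <;> ring
  | smul c x hx => rw [smul_mul_assoc, map_smul, hx]; split_ifs <;> simp <;> ring

/-- A right ideal criterion: closure under the generators implies closure under the algebra. -/
theorem mul_mem_of_adj (hT : IsHeckeBasis q T) {N : Submodule F H}
    (hN : ∀ x ∈ N, ∀ i h, x * T (adjT i h) ∈ N) {x : H} (hx : x ∈ N) (y : H) : x * y ∈ N := by
  induction y using hT.T_induction with
  | basis w =>
    induction w using perm_length_induction with
    | one => rwa [hT.one, mul_one]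
    | step w i h hw ih => rw [← hT.mul_asc hw, ← mul_assoc]; exact hN _ ih i h
  | zero => rw [mul_zero]; exact N.zero_mem
  | add a b ha hb => rw [mul_add]; exact N.add_mem ha hb
  | smul c a ha => rw [mul_smul_comm]; exact N.smul_mem c ha

/-- Left multiplication by a generator in the length-increasing case. -/
theorem adj_mul (hT : IsHeckeBasis q T) {p : ℕ} {hp : p + 1 < n} (w : Equiv.Perm (Fin n))
    (hw : w ⟨p, by omega⟩ < w ⟨p + 1, hp⟩) : T (adjT p hp) * T w = T (w * adjT p hp) := by
  induction w using perm_length_induction with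
  | one => rw [hT.one, mul_one, one_mul]
  | step w i h ha ih =>
    simp only [Equiv.Perm.mul_apply] at hw
    have key : w ⟨p, by omega⟩ < w ⟨p + 1, hp⟩ := by
      by_contra hc
      have hne : w ⟨p + 1, hp⟩ ≠ w ⟨p, by omega⟩ := fun he => by
        have := w.injective he
        simp at this
      have hlt := lt_of_le_of_ne (not_lt.1 hc) hne
      by_cases hh : (w ⟨p + 1, hp⟩ : ℕ) = i ∧ (w ⟨p, by omega⟩ : ℕ) = i + 1
      · have e1 : w⁻¹ ⟨i, by omega⟩ = ⟨p + 1, hp⟩ := by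
          rw [Equiv.Perm.inv_eq_iff_eq]; exact Fin.ext hh.1.symm
        have e2 : w⁻¹ ⟨i + 1, h⟩ = ⟨p, by omega⟩ := by
          rw [Equiv.Perm.inv_eq_iff_eq]; exact Fin.ext hh.2.symm
        unfold Asc at ha
        rw [e1, e2, Fin.mk_lt_mk] at ha
        omega
      · exact (adjT_lt hlt hh).not_gt hw
    have ha' : Asc (w * adjT p hp) i h := by
      unfold Asc at *
      rw [mul_inv_rev, adjT_inv, Equiv.Perm.mul_apply, Equiv.Perm.mul_apply]
      refine adjT_lt ha ?_
      rintro ⟨h1, h2⟩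
      have e1 : w ⟨p, by omega⟩ = ⟨i, by omega⟩ := by
        rw [← Equiv.Perm.eq_inv_iff_eq]; exact Fin.ext h1.symm
      have e2 : w ⟨p + 1, hp⟩ = ⟨i + 1, h⟩ := by
        rw [← Equiv.Perm.eq_inv_iff_eq]; exact Fin.ext h2.symm
      rw [e1, e2, adjT_left, adjT_right, Fin.mk_lt_mk] at hw
      omega
    rw [← hT.mul_asc ha, ← mul_assoc, ih key, hT.mul_asc ha', mul_assoc]

/-- The coefficient at `a` of `x T_d`, when no inversion of `d⁻¹` is an inversion of `a⁻¹`. -/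
theorem coef_mul_T (hT : IsHeckeBasis q T) (x : H) (d a : Equiv.Perm (Fin n))
    (had : ∀ k l : Fin n, k < l → d⁻¹ l < d⁻¹ k → a⁻¹ k < a⁻¹ l) :
    hT.coef a (x * T d) = q ^ permLength d * hT.coef (d⁻¹ * a) x := by
  induction d using perm_length_induction generalizing a with
  | one => simp [hT.one, permLength_one]
  | step d i h hd ih =>
    have haa : Asc a i h := by
      refine had _ _ (by simp) ?_
      simp only [mul_inv_rev, adjT_inv, Equiv.Perm.mul_apply, adjT_left, adjT_right]
      exact hd
    rw [← hT.mul_asc hd, ← mul_assoc, hT.coef_mul_adj, if_pos haa, hd.permLength, ih]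
    · rw [mul_inv_rev, adjT_inv, mul_assoc]; ring
    · intro k l hkl hlt
      have hne : ¬ ((k : ℕ) = i ∧ (l : ℕ) = i + 1) := by
        rintro ⟨h1, h2⟩
        have e1 : k = ⟨i, Nat.lt_of_succ_lt h⟩ := Fin.ext h1
        have e2 : l = ⟨i + 1, h⟩ := Fin.ext h2
        rw [e1, e2] at hlt
        exact hlt.not_gt hd
      have := had _ _ (adjT_lt (h := h) hkl hne)
      simp only [mul_inv_rev, adjT_inv, Equiv.Perm.mul_apply, adjT_adjT] at this ⊢
      exact this hlt

/-- An eigenvector of the generator `T_i` with eigenvalue `q` is killed by `y_κ` when the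
transposition `(i, i+1)` lies in `W_κ`. -/
theorem mul_yElt_eq_zero (hT : IsHeckeBasis q T) (hq : q ≠ 0) {Z : H} {p : ℕ} {hp : p + 1 < n}
    (hZ : Z * T (adjT p hp) = q • Z) {kap : ℕ → ℕ} (hk : rowOf kap p = rowOf kap (p + 1)) :
    Z * yElt q T kap = 0 := by
  have hmem : ∀ w ∈ youngW (n := n) kap, w * adjT p hp ∈ youngW (n := n) kap := by
    intro w hw x
    rw [Equiv.Perm.mul_apply, hw, adjT_val]
    split_ifs with h1 h2
    · rw [h1, hk]
    · rw [h2, hk]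
    · rfl
  have hne : ∀ w : Equiv.Perm (Fin n), w ⟨p, by omega⟩ ≠ w ⟨p + 1, hp⟩ := fun w he => by
    have := w.injective he
    simp at this
  have hpair : ∀ w : Equiv.Perm (Fin n), w ⟨p, by omega⟩ < w ⟨p + 1, hp⟩ →
      ((-q)⁻¹) ^ permLength w • (Z * T w) +
        ((-q)⁻¹) ^ permLength (w * adjT p hp) • (Z * T (w * adjT p hp)) = 0 := by
    intro w hw
    have hl : permLength (w * adjT p hp) = permLength w + 1 := by
      rw [← permLength_inv, mul_inv_rev, adjT_inv, Asc.permLength, permLength_inv]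
      unfold Asc
      rwa [inv_inv]
    rw [← hT.adj_mul w hw, ← mul_assoc, hZ, hl, smul_mul_assoc, smul_smul, ← add_smul]
    convert zero_smul F _
    rw [pow_succ, inv_neg]
    field_simp
    ring
  rw [yElt, Finset.mul_sum]
  simp only [mul_smul_comm]
  refine Finset.sum_involution (fun w _ => w * adjT p hp) ?_ ?_ ?_ ?_
  · intro w _
    rcases lt_or_gt_of_ne (hne w) with hw | hw
    · exact hpair w hw
    · have := hpair (w * adjT p hp) (by
        simpa only [Equiv.Perm.mul_apply, adjT_left, adjT_right] using hw)
      rwa [mul_assoc, adjT_mul_self, mul_one, add_comm] at this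
  · intro w _ _ he
    have := congrArg (fun v : Equiv.Perm (Fin n) => v ⟨p, by omega⟩) he
    simp only [Equiv.Perm.mul_apply, adjT_left] at this
    exact hne w this.symm
  · intro w hw
    simp only [Finset.mem_filter, Finset.mem_univ, true_and] at hw ⊢
    exact hmem w hw
  · intro w _
    rw [mul_assoc, adjT_mul_self, mul_one]

end IsHeckeBasis

section Words

variable {α : Type*} [LinearOrder α]

theorem sort_inv_lt_iff (g : Fin n → α) (k l : Fin n) :
    (Tuple.sort g)⁻¹ k < (Tuple.sort g)⁻¹ l ↔ g k < g l ∨ g k = g l ∧ k < l := by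
  have hs := Tuple.eq_sort_iff.1 (rfl : Tuple.sort g = Tuple.sort g)
  have key : ∀ k l : Fin n, g k < g l ∨ g k = g l ∧ k < l →
      (Tuple.sort g)⁻¹ k < (Tuple.sort g)⁻¹ l := by
    rintro k l (hkl | ⟨he, hkl⟩)
    · by_contra hc
      have := hs.1 (not_lt.1 hc)
      simp only [Function.comp_apply] at this
      rw [Equiv.Perm.coe_inv, Equiv.apply_symm_apply, Equiv.apply_symm_apply] at this
      exact this.not_gt hkl
    · by_contra hc
      have hne : (Tuple.sort g)⁻¹ l ≠ (Tuple.sort g)⁻¹ k :=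
        fun h => hkl.ne' ((Tuple.sort g)⁻¹.injective h)
      have := hs.2 _ _ (lt_of_le_of_ne (not_lt.1 hc) hne) (by simpa using he.symm)
      rw [Equiv.Perm.coe_inv, Equiv.apply_symm_apply, Equiv.apply_symm_apply] at this
      exact this.not_gt hkl
  refine ⟨fun h => ?_, key k l⟩
  by_contra hc
  push Not at hc
  rcases eq_or_ne k l with rfl | hne
  · exact lt_irrefl _ h
  · refine (key l k ?_).not_gt h
    rcases lt_or_eq_of_le hc.1 with h1 | h1
    · exact Or.inl h1
    · exact Or.inr ⟨h1, lt_of_le_of_ne (hc.2 h1.symm) hne.symm⟩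

theorem asc_sort_iff (g : Fin n → α) (i : ℕ) (h : i + 1 < n) :
    Asc (Tuple.sort g) i h ↔ g ⟨i, by omega⟩ ≤ g ⟨i + 1, h⟩ := by
  unfold Asc
  rw [sort_inv_lt_iff, le_iff_lt_or_eq]
  simp

theorem sort_comp_adjT (g : Fin n → α) (i : ℕ) (h : i + 1 < n)
    (hg : g ⟨i, by omega⟩ ≠ g ⟨i + 1, h⟩) :
    Tuple.sort (g ∘ adjT i h) = adjT i h * Tuple.sort g := by
  symm
  have hs := Tuple.eq_sort_iff.1 (rfl : Tuple.sort g = Tuple.sort g)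
  rw [Tuple.eq_sort_iff]
  constructor
  · intro a b hab
    simpa only [Function.comp_apply, Equiv.Perm.mul_apply, adjT_adjT] using hs.1 hab
  · intro a b hab he
    simp only [Function.comp_apply, Equiv.Perm.mul_apply, adjT_adjT] at he ⊢
    refine adjT_lt (hs.2 a b hab he) ?_
    rintro ⟨h1, h2⟩
    have e1 : Tuple.sort g a = ⟨i, by omega⟩ := Fin.ext h1
    have e2 : Tuple.sort g b = ⟨i + 1, h⟩ := Fin.ext h2
    rw [e1, e2] at he
    exact hg he

namespace IsHeckeBasis

variable {q : F} {T : Equiv.Perm (Fin n) → H}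

theorem mul_sort_of_ne (hT : IsHeckeBasis q T) (X : H) {g : Fin n → α} {i : ℕ} {h : i + 1 < n}
    (hg : g ⟨i, by omega⟩ ≠ g ⟨i + 1, h⟩) :
    X * T (Tuple.sort g) * T (adjT i h) =
      if g ⟨i, by omega⟩ < g ⟨i + 1, h⟩ then X * T (Tuple.sort (g ∘ adjT i h))
      else q • (X * T (Tuple.sort (g ∘ adjT i h))) + (q - 1) • (X * T (Tuple.sort g)) := by
  rw [sort_comp_adjT g i h hg, mul_assoc]
  split_ifs with hlt
  · rw [hT.mul_asc ((asc_sort_iff g i h).2 hlt.le)]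
  · rw [hT.mul_desc, mul_add, mul_smul_comm, mul_smul_comm]
    rw [asc_sort_iff, le_iff_lt_or_eq]
    exact not_or.2 ⟨hlt, hg⟩

theorem mul_sort_of_eq (hT : IsHeckeBasis q T) {X : H} {g₀ : Fin n → α}
    (hX : ∀ p (hp : p + 1 < n), g₀ ⟨p, by omega⟩ = g₀ ⟨p + 1, hp⟩ → X * T (adjT p hp) = q • X)
    {g : Fin n → α} (hg₀ : g ∘ Tuple.sort g = g₀) {i : ℕ} {h : i + 1 < n}
    (hg : g ⟨i, by omega⟩ = g ⟨i + 1, h⟩) :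
    X * T (Tuple.sort g) * T (adjT i h) = q • (X * T (Tuple.sort g)) := by
  set σ := Tuple.sort g with hσ
  have hs := Tuple.eq_sort_iff.1 hσ
  have hasc : σ⁻¹ ⟨i, by omega⟩ < σ⁻¹ ⟨i + 1, h⟩ := (asc_sort_iff g i h).2 hg.le
  obtain ⟨p, hp⟩ : ∃ p : Fin n, σ⁻¹ ⟨i, by omega⟩ = p := ⟨_, rfl⟩
  obtain ⟨p', hp'⟩ : ∃ p' : Fin n, σ⁻¹ ⟨i + 1, h⟩ = p' := ⟨_, rfl⟩
  rw [hp, hp'] at hasc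
  rw [Equiv.Perm.inv_eq_iff_eq] at hp hp'
  have hlt : (p : ℕ) + 1 < n := by
    have := p'.2
    rw [Fin.lt_def] at hasc
    omega
  have hstep : (p' : ℕ) = p + 1 := by
    by_contra hc
    rw [Fin.lt_def] at hasc
    have h1 : p < ⟨p + 1, hlt⟩ := by rw [Fin.lt_def]; simp
    have h2 : ⟨p + 1, hlt⟩ < p' := by rw [Fin.lt_def]; simp only; omega
    have m1 := hs.1 h1.le
    have m2 := hs.1 h2.le
    simp only [Function.comp_apply, ← hp, ← hp'] at m1 m2
    rw [← hg] at m2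
    have e := le_antisymm m1 m2
    have s1 := hs.2 _ _ h1 (by rw [← hp]; exact e)
    have s2 := hs.2 _ _ h2 (by rw [← hp', ← hg]; exact e.symm)
    rw [← hp, Fin.lt_def] at s1
    rw [← hp', Fin.lt_def] at s2
    simp only at s1 s2
    omega
  have e2 : p' = ⟨p + 1, hlt⟩ := Fin.ext hstep
  have hcomm : adjT i h * σ = σ * adjT p hlt := by
    have : σ * adjT p hlt * σ⁻¹ = adjT i h := by
      unfold adjT
      rw [← Equiv.swap_apply_apply]
      congr 1
      · exact hp.symm
      · rw [← e2]; exact hp'.symm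
    rw [← this]; group
  have hw : σ ⟨p, by omega⟩ < σ ⟨p + 1, hlt⟩ := by
    rw [← e2, ← hp', Fin.eta, ← hp]; simp
  rw [mul_assoc, hT.mul_asc ((asc_sort_iff g i h).2 hg.le), hcomm, ← hT.adj_mul σ hw, ← mul_assoc,
    hX, smul_mul_assoc]
  rw [← hg₀]
  simp only [Function.comp_apply, Fin.eta]
  rw [← e2, ← hp, ← hp', hg]

theorem comp_adjT_comp_sort {g₀ g : Fin n → α} (hg₀ : g ∘ Tuple.sort g = g₀) (i : ℕ)
    (h : i + 1 < n) : (g ∘ adjT i h) ∘ Tuple.sort (g ∘ adjT i h) = g₀ :=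
  Tuple.comp_perm_comp_sort_eq_comp_sort.trans hg₀

theorem comp_adjT_of_eq {β : Type*} {g : Fin n → β} {i : ℕ} {h : i + 1 < n}
    (hg : g ⟨i, by omega⟩ = g ⟨i + 1, h⟩) : g ∘ adjT i h = g := by
  funext x
  have := adjT_val i h x
  simp only [Function.comp_apply]
  split_ifs at this with h1 h2
  · have e1 : adjT i h x = ⟨i + 1, h⟩ := Fin.ext this
    have e2 : x = ⟨i, by omega⟩ := Fin.ext h1
    rw [e1, e2, hg]
  · have e1 : adjT i h x = ⟨i, Nat.lt_of_succ_lt h⟩ := Fin.ext this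
    have e2 : x = ⟨i + 1, h⟩ := Fin.ext h2
    rw [e1, e2, hg]
  · rw [Fin.ext this]

/-- The sum of the `X T_{sort g}` over a set of words stable under exchanging the letters in
positions `i` and `i + 1` is an eigenvector of `T_i`. -/
theorem sum_sort_mul_adj (hT : IsHeckeBasis q T) {X : H} {g₀ : Fin n → α}
    (hX : ∀ p (hp : p + 1 < n), g₀ ⟨p, by omega⟩ = g₀ ⟨p + 1, hp⟩ → X * T (adjT p hp) = q • X)
    (B : Finset (Fin n → α)) (hB : ∀ g ∈ B, g ∘ Tuple.sort g = g₀) {i : ℕ} {h : i + 1 < n}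
    (hi : ∀ g ∈ B, g ∘ adjT i h ∈ B) :
    (∑ g ∈ B, X * T (Tuple.sort g)) * T (adjT i h) = q • ∑ g ∈ B, X * T (Tuple.sort g) := by
  have hinv : ∀ g : Fin n → α, (g ∘ adjT i h) ∘ adjT i h = g := fun g => by
    funext x; simp only [Function.comp_apply, adjT_adjT]
  rw [← sub_eq_zero, Finset.sum_mul, Finset.smul_sum, ← Finset.sum_sub_distrib]
  refine Finset.sum_involution (fun g _ => g ∘ adjT i h) ?_ ?_ (fun g hg => hi g hg)
    (fun g _ => hinv g)
  · intro g hg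
    by_cases he : g ⟨i, by omega⟩ = g ⟨i + 1, h⟩
    · rw [comp_adjT_of_eq he, hT.mul_sort_of_eq hX (hB g hg) he, sub_self, add_zero]
    · have he' : (g ∘ adjT i h) ⟨i, by omega⟩ ≠ (g ∘ adjT i h) ⟨i + 1, h⟩ := by
        simpa only [Function.comp_apply, adjT_left, adjT_right] using Ne.symm he
      rw [hT.mul_sort_of_ne X he, hT.mul_sort_of_ne X he', hinv]
      simp only [Function.comp_apply, adjT_left, adjT_right]
      rcases lt_or_gt_of_ne he with hlt | hlt
      · rw [if_pos hlt, if_neg hlt.not_gt]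
        module
      · rw [if_neg hlt.not_gt, if_pos hlt]
        module
  · intro g hg hne he
    refine hne ?_
    have he' : g ⟨i, by omega⟩ = g ⟨i + 1, h⟩ := by
      have := congrFun he ⟨i + 1, h⟩
      simpa only [Function.comp_apply, adjT_right] using this
    rw [hT.mul_sort_of_eq hX (hB g hg) he', sub_self]

/-- The right ideal generated by `X` is killed by `y_κ` if every rearrangement of the word `g₀`
has two equal adjacent letters in some block of `κ`. -/
theorem mul_mul_yElt_eq_zero (hT : IsHeckeBasis q T) (hq : q ≠ 0) {X : H} {g₀ : Fin n → α}
    (hX : ∀ p (hp : p + 1 < n), g₀ ⟨p, by omega⟩ = g₀ ⟨p + 1, hp⟩ → X * T (adjT p hp) = q • X)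
    (hmono : Monotone g₀) {kap : ℕ → ℕ}
    (hk : ∀ g : Fin n → α, g ∘ Tuple.sort g = g₀ → ∃ (i : ℕ) (h : i + 1 < n),
      rowOf kap i = rowOf kap (i + 1) ∧ g ⟨i, by omega⟩ = g ⟨i + 1, h⟩) (y : H) :
    X * y * yElt q T kap = 0 := by
  set N := Submodule.span F
    {z | ∃ g : Fin n → α, g ∘ Tuple.sort g = g₀ ∧ X * T (Tuple.sort g) = z} with hN
  have hgen : ∀ g : Fin n → α, g ∘ Tuple.sort g = g₀ → X * T (Tuple.sort g) ∈ N :=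
    fun g hg => Submodule.subset_span ⟨g, hg, rfl⟩
  have hXN : X ∈ N := by
    have hs := Tuple.sort_eq_refl_iff_monotone.2 hmono
    have h1 := hgen g₀ (by rw [hs]; rfl)
    have h2 : T (Equiv.refl _) = 1 := hT.one
    rwa [hs, h2, mul_one] at h1
  have hmem : X * y ∈ N := by
    refine hT.mul_mem_of_adj (fun x hx i h => ?_) hXN y
    induction hx using Submodule.span_induction with
    | mem x hx =>
      obtain ⟨g, hg, rfl⟩ := hx
      by_cases he : g ⟨i, by omega⟩ = g ⟨i + 1, h⟩
      · rw [hT.mul_sort_of_eq hX hg he]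
        exact Submodule.smul_mem _ _ (hgen g hg)
      · rw [hT.mul_sort_of_ne X he]
        have hm := hgen _ (comp_adjT_comp_sort hg i h)
        split_ifs
        · exact hm
        · exact N.add_mem (N.smul_mem _ hm) (N.smul_mem _ (hgen g hg))
    | zero => rw [zero_mul]; exact N.zero_mem
    | add a b _ _ ha hb => rw [add_mul]; exact N.add_mem ha hb
    | smul c a _ ha => rw [smul_mul_assoc]; exact N.smul_mem _ ha
  generalize X * y = z at hmem
  induction hmem using Submodule.span_induction with
  | mem x hx =>
    obtain ⟨g, hg, rfl⟩ := hx
    obtain ⟨i, h, hrow, he⟩ := hk g hg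
    exact hT.mul_yElt_eq_zero hq (hT.mul_sort_of_eq hX hg he) hrow
  | zero => rw [zero_mul]
  | add a b _ _ ha hb => rw [add_mul, ha, hb, add_zero]
  | smul c a _ ha => rw [smul_mul_assoc, ha, smul_zero]

end IsHeckeBasis

end Words

end HeckeAlgebra

section QBinomial

variable {F : Type*} [Field F] (q : F)

theorem qBinom_zero_right (a : ℕ) : qBinom q a 0 = 1 := by cases a <;> rfl

theorem qBinom_succ_succ (a b : ℕ) :
    qBinom q (a + 1) (b + 1) = qBinom q a b + q ^ (b + 1) * qBinom q a (b + 1) := rfl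

theorem qBinom_eq_zero {a b : ℕ} (h : a < b) : qBinom q a b = 0 := by
  induction a generalizing b with
  | zero => obtain ⟨b, rfl⟩ := Nat.exists_eq_add_of_lt h; rfl
  | succ a ih =>
    obtain ⟨b, rfl⟩ : ∃ c, b = c + 1 := ⟨b - 1, by omega⟩
    rw [qBinom_succ_succ, ih (by omega), ih (by omega)]
    ring

theorem qBinom_self (a : ℕ) : qBinom q a a = 1 := by
  induction a with
  | zero => rfl
  | succ a ih => rw [qBinom_succ_succ, ih, qBinom_eq_zero q (Nat.lt_succ_self a)]; ring

theorem qBinom_absorption (a b : ℕ) :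
    (1 - q ^ (b + 1)) * qBinom q (a + b + 1) a =
      (1 - q ^ (a + 1)) * qBinom q (a + b + 1) (a + 1) := by
  induction hs : a + b generalizing a b with
  | zero =>
    obtain ⟨rfl, rfl⟩ : a = 0 ∧ b = 0 := by omega
    simp [qBinom_self, qBinom_zero_right]
  | succ s ih =>
    rcases a with _ | a
    · obtain ⟨b, rfl⟩ : ∃ c, b = c + 1 := ⟨b - 1, by omega⟩
      have h := ih 0 b (by omega)
      rw [qBinom_zero_right] at h
      rw [qBinom_succ_succ q (s + 1) 0, qBinom_zero_right, qBinom_zero_right]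
      linear_combination q * h
    · rcases b with _ | b
      · have h := ih a 0 (by omega)
        obtain rfl : s = a := by omega
        rw [qBinom_succ_succ q (s + 1) s, qBinom_self, qBinom_self] at *
        linear_combination h
      · have h1 := ih a (b + 1) (by omega)
        have h2 := ih (a + 1) b (by omega)
        rw [qBinom_succ_succ q (s + 1) a, qBinom_succ_succ q (s + 1) (a + 1)]
        linear_combination h1 + q ^ (a + 2) * h2

theorem qBinom_succ_succ' (a b : ℕ) :
    qBinom q (a + b + 2) (a + 1) =
      q ^ (b + 1) * qBinom q (a + b + 1) a + qBinom q (a + b + 1) (a + 1) := by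
  rw [qBinom_succ_succ]
  linear_combination qBinom_absorption q a b

theorem qBinom_symm (a b : ℕ) : qBinom q (a + b) a = qBinom q (a + b) b := by
  induction hs : a + b generalizing a b with
  | zero =>
    obtain ⟨rfl, rfl⟩ : a = 0 ∧ b = 0 := by omega
    rfl
  | succ s ih =>
    rcases a with _ | a
    · obtain rfl : b = s + 1 := by omega
      rw [qBinom_self, qBinom_zero_right]
    · rcases b with _ | b
      · obtain rfl : a = s := by omega
        rw [qBinom_self, qBinom_zero_right]
      · obtain rfl : s = a + b + 1 := by omega
        have h1 := ih a (b + 1) (by omega)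
        have h2 := ih (a + 1) b (by omega)
        rw [qBinom_succ_succ q (a + b + 1) b]
        linear_combination qBinom_succ_succ' q a b + q ^ (b + 1) * h1 + h2

theorem qBinomProd_symm (A B : Multiset ℕ) : qBinomProd q A B = qBinomProd q B A := by
  unfold qBinomProd
  rw [add_comm B A]
  refine Finset.prod_congr rfl fun i _ => ?_
  rw [Multiset.count_add, qBinom_symm]

theorem qBinomProd_eq {A B : Multiset ℕ} {E : Finset ℕ} {j : ℕ} (hj : j ∈ E)
    (hE : (A + B).toFinset ⊆ E) :
    qBinomProd q A B = qBinom q (A.count j + B.count j) (A.count j) *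
      ∏ i ∈ E.erase j, qBinom q (A.count i + B.count i) (A.count i) := by
  rw [Finset.mul_prod_erase E (fun i => qBinom q (A.count i + B.count i) (A.count i)) hj,
    qBinomProd]
  simp only [Multiset.count_add]
  refine Finset.prod_subset hE fun i _ hi => ?_
  rw [Multiset.mem_toFinset, ← Multiset.count_eq_zero, Multiset.count_add] at hi
  obtain ⟨h1, h2⟩ : A.count i = 0 ∧ B.count i = 0 := by omega
  rw [h1, qBinom_zero_right]

theorem invPairs_cons_left (a : ℕ) (A B : Multiset ℕ) :
    invPairs (a ::ₘ A) B = (B.filter (· < a)).card + invPairs A B := by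
  unfold invPairs
  have : (a ::ₘ A).product B = B.map (Prod.mk a) + A.product B := Multiset.cons_product a A B
  rw [this, Multiset.filter_add, Multiset.card_add, Multiset.filter_map, Multiset.card_map]
  rfl

theorem invPairs_cons_right (b : ℕ) (A B : Multiset ℕ) :
    invPairs A (b ::ₘ B) = (A.filter (b < ·)).card + invPairs A B := by
  unfold invPairs
  have : A.product (b ::ₘ B) = A.map (fun a => (a, b)) + A.product B := Multiset.product_cons b A B
  rw [this, Multiset.filter_add, Multiset.card_add, Multiset.filter_map, Multiset.card_map]
  rfl

/-- The weighted number of ways of splitting a sorted word with content `R ⊔ U` into a subword of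
content `R` and a complementary subword of content `U`. -/
def splitWeight (R U : Multiset ℕ) : F := q ^ invPairs R U * qBinomProd q R U

theorem filter_lt_eq_zero {j : ℕ} {A : Multiset ℕ} (hA : ∀ x ∈ A, j ≤ x) :
    A.filter (· < j) = 0 := by
  rw [Multiset.filter_eq_nil]
  exact fun x hx => not_lt.2 (hA x hx)

theorem card_filter_gt {j : ℕ} {A : Multiset ℕ} (hA : ∀ x ∈ A, j ≤ x) :
    (A.filter (j < ·)).card + A.count j = A.card := by
  conv_rhs => rw [← Multiset.filter_add_not (j < ·) A, Multiset.card_add]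
  congr 1
  rw [Multiset.count_eq_card_filter_eq]
  congr 1
  refine Multiset.filter_congr fun x hx => ?_
  have := hA x hx
  omega

theorem splitWeight_cons_right {j : ℕ} {R U : Multiset ℕ} (hR : ∀ x ∈ R, j < x) :
    splitWeight q R (j ::ₘ U) = q ^ R.card * splitWeight q R U := by
  have hc : R.count j = 0 := Multiset.count_eq_zero.2 fun h => lt_irrefl _ (hR j h)
  have h := card_filter_gt fun x hx => (hR x hx).le
  rw [hc, add_zero] at h
  have hE : (R + U).toFinset ⊆ insert j (R + U).toFinset := Finset.subset_insert _ _
  have hE' : (R + j ::ₘ U).toFinset ⊆ insert j (R + U).toFinset := by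
    rw [Multiset.add_cons, Multiset.toFinset_cons]
  rw [splitWeight, splitWeight, invPairs_cons_right, h,
    qBinomProd_eq q (Finset.mem_insert_self _ _) hE,
    qBinomProd_eq q (Finset.mem_insert_self _ _) hE',
    hc, qBinom_zero_right, qBinom_zero_right, pow_add]
  rw [Finset.prod_congr rfl fun i hi => by
    rw [Multiset.count_cons_of_ne (Finset.ne_of_mem_erase hi)]]
  ring

theorem splitWeight_cons_left {j : ℕ} {R U : Multiset ℕ} (hU : ∀ x ∈ U, j < x) :
    splitWeight q (j ::ₘ R) U = splitWeight q R U := by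
  have hc : U.count j = 0 := Multiset.count_eq_zero.2 fun h => lt_irrefl _ (hU j h)
  have hE : (R + U).toFinset ⊆ insert j (R + U).toFinset := Finset.subset_insert _ _
  have hE' : (j ::ₘ R + U).toFinset ⊆ insert j (R + U).toFinset := by
    rw [Multiset.cons_add, Multiset.toFinset_cons]
  rw [splitWeight, splitWeight, invPairs_cons_left, filter_lt_eq_zero fun x hx => (hU x hx).le,
    qBinomProd_eq q (Finset.mem_insert_self _ _) hE,
    qBinomProd_eq q (Finset.mem_insert_self _ _) hE',
    hc, add_zero, add_zero, qBinom_self, qBinom_self, Multiset.card_zero, zero_add]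
  congr 2
  refine Finset.prod_congr rfl fun i hi => ?_
  rw [Multiset.count_cons_of_ne (Finset.ne_of_mem_erase hi)]

theorem splitWeight_cons_cons {j : ℕ} {R U : Multiset ℕ} (hR : ∀ x ∈ R, j ≤ x)
    (hU : ∀ x ∈ U, j ≤ x) :
    splitWeight q (j ::ₘ R) (j ::ₘ U) =
      q ^ (R.card + 1) * splitWeight q (j ::ₘ R) U + splitWeight q R (j ::ₘ U) := by
  set E := insert j (R + U).toFinset with hE
  have hj : j ∈ E := Finset.mem_insert_self _ _
  have h1 : (j ::ₘ R + j ::ₘ U).toFinset ⊆ E := by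
    rw [Multiset.cons_add, Multiset.add_cons, Multiset.toFinset_cons, Multiset.toFinset_cons,
      Finset.insert_idem]
  have h2 : (j ::ₘ R + U).toFinset ⊆ E := by
    rw [Multiset.cons_add, Multiset.toFinset_cons]
  have h3 : (R + j ::ₘ U).toFinset ⊆ E := by
    rw [Multiset.add_cons, Multiset.toFinset_cons]
  have hcard := card_filter_gt hR
  have hz := filter_lt_eq_zero hU
  have hz' : (j ::ₘ U).filter (· < j) = 0 :=
    filter_lt_eq_zero (Multiset.forall_mem_cons.2 ⟨le_rfl, hU⟩)
  have p : ∀ A B : Multiset ℕ, ∏ i ∈ E.erase j, qBinom q (A.count i + (j ::ₘ B).count i) (A.count i)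
      = ∏ i ∈ E.erase j, qBinom q (A.count i + B.count i) (A.count i) := fun A B =>
    Finset.prod_congr rfl fun i hi => by
      rw [Multiset.count_cons_of_ne (Finset.ne_of_mem_erase hi)]
  have p' : ∀ A B : Multiset ℕ,
      ∏ i ∈ E.erase j, qBinom q ((j ::ₘ A).count i + B.count i) ((j ::ₘ A).count i)
      = ∏ i ∈ E.erase j, qBinom q (A.count i + B.count i) (A.count i) := fun A B =>
    Finset.prod_congr rfl fun i hi => by
      rw [Multiset.count_cons_of_ne (Finset.ne_of_mem_erase hi)]
  simp only [splitWeight]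
  rw [qBinomProd_eq q hj h1, qBinomProd_eq q hj h2, qBinomProd_eq q hj h3, p, p, p',
    invPairs_cons_left, invPairs_cons_left, hz, hz', invPairs_cons_right, ← hcard]
  simp only [Multiset.count_cons_self, Multiset.card_zero, zero_add]
  rw [show R.count j + 1 + (U.count j + 1) = R.count j + U.count j + 1 + 1 by ring,
    show R.count j + 1 + U.count j = R.count j + U.count j + 1 by ring,
    show R.count j + (U.count j + 1) = R.count j + U.count j + 1 by ring,
    qBinom_succ_succ q (R.count j + U.count j + 1)]
  ring

theorem splitWeight_rec {j : ℕ} {R U : Multiset ℕ} (hmem : j ∈ R + U) (hmin : ∀ x ∈ R + U, j ≤ x) :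
    splitWeight q R U = (if j ∈ U then q ^ R.card * splitWeight q R (U.erase j) else 0) +
      if j ∈ R then splitWeight q (R.erase j) U else 0 := by
  have hmR : ∀ x ∈ R, j ≤ x := fun x hx => hmin x (Multiset.mem_add.2 (Or.inl hx))
  have hmU : ∀ x ∈ U, j ≤ x := fun x hx => hmin x (Multiset.mem_add.2 (Or.inr hx))
  by_cases hU : j ∈ U <;> by_cases hR : j ∈ R
  · obtain ⟨R, rfl⟩ := Multiset.exists_cons_of_mem hR
    obtain ⟨U, rfl⟩ := Multiset.exists_cons_of_mem hU
    rw [if_pos hU, if_pos hR, Multiset.erase_cons_head, Multiset.erase_cons_head,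
      Multiset.card_cons]
    exact splitWeight_cons_cons q (fun x hx => hmR x (Multiset.mem_cons_of_mem hx))
      (fun x hx => hmU x (Multiset.mem_cons_of_mem hx))
  · obtain ⟨U, rfl⟩ := Multiset.exists_cons_of_mem hU
    rw [if_pos hU, if_neg hR, Multiset.erase_cons_head, add_zero]
    exact splitWeight_cons_right q fun x hx =>
      lt_of_le_of_ne (hmR x hx) fun h => hR (h ▸ hx)
  · obtain ⟨R, rfl⟩ := Multiset.exists_cons_of_mem hR
    rw [if_neg hU, if_pos hR, Multiset.erase_cons_head, zero_add]
    exact splitWeight_cons_left q fun x hx =>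
      lt_of_le_of_ne (hmU x hx) fun h => hU (h ▸ hx)
  · exact absurd (Multiset.mem_add.1 hmem) (by tauto)

/-- The number of inversions created by placing the elements of `P` before those of `s \ P`. -/
def splitInv {ι : Type*} [LinearOrder ι] (s P : Finset ι) : ℕ :=
  (((s \ P) ×ˢ P).filter fun p => p.1 < p.2).card

theorem splitInv_insert_of_lt {ι : Type*} [LinearOrder ι] {s P : Finset ι} {a : ι}
    (ha : ∀ x ∈ s, a < x) (hP : P ⊆ s) : splitInv (insert a s) P = P.card + splitInv s P := by
  have has : a ∉ s := fun h => lt_irrefl _ (ha a h)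
  have haP : a ∉ P := fun h => has (hP h)
  unfold splitInv
  rw [Finset.insert_sdiff_of_notMem _ haP, Finset.insert_eq, Finset.union_product,
    Finset.filter_union, Finset.card_union_of_disjoint]
  · congr 1
    rw [Finset.filter_true_of_mem, Finset.card_product, Finset.card_singleton, one_mul]
    intro p hp
    obtain ⟨h1, h2⟩ := Finset.mem_product.1 hp
    rw [Finset.mem_singleton.1 h1]
    exact ha _ (hP h2)
  · rw [Finset.disjoint_left]
    rintro ⟨x, y⟩ hx hy
    simp only [Finset.mem_filter, Finset.mem_product, Finset.mem_sdiff, Finset.mem_singleton]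
      at hx hy
    exact has (hx.1.1 ▸ hy.1.1.1)

theorem splitInv_insert_insert {ι : Type*} [LinearOrder ι] {s P : Finset ι} {a : ι}
    (ha : ∀ x ∈ s, a < x) : splitInv (insert a s) (insert a P) = splitInv s P := by
  have has : a ∉ s := fun h => lt_irrefl _ (ha a h)
  unfold splitInv
  congr 1
  ext ⟨x, y⟩
  rw [Finset.insert_sdiff_insert, Finset.sdiff_insert_of_notMem has]
  simp only [Finset.mem_filter, Finset.mem_product, Finset.mem_insert, Finset.mem_sdiff]
  constructor
  · rintro ⟨⟨hx, rfl | hy⟩, hlt⟩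
    · exact absurd hlt (ha x hx.1).not_gt
    · exact ⟨⟨hx, hy⟩, hlt⟩
  · rintro ⟨⟨hx, hy⟩, hlt⟩
    exact ⟨⟨hx, Or.inr hy⟩, hlt⟩

theorem sum_split {ι : Type*} [LinearOrder ι] (s : Finset ι) (f : ι → ℕ) (hf : MonotoneOn f s)
    (R U : Multiset ℕ) :
    (∑ P ∈ s.powerset, if P.val.map f = R ∧ (s \ P).val.map f = U then q ^ splitInv s P else 0) =
      if s.val.map f = R + U then splitWeight q R U else 0 := by
  induction s using Finset.induction_on_min generalizing R U with
  | empty =>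
    have hm : (∅ : Finset ι).val.map f = 0 := rfl
    have hinv : invPairs 0 0 = 0 := rfl
    rw [Finset.powerset_empty, Finset.sum_singleton, Finset.empty_sdiff, hm]
    by_cases h : R = 0 ∧ U = 0
    · obtain ⟨rfl, rfl⟩ := h
      simp [splitWeight, splitInv, hinv, qBinomProd]
    · rw [if_neg fun h0 => h ⟨h0.1.symm, h0.2.symm⟩, if_neg]
      intro h0
      exact h (by simpa using h0.symm)
  | insert a s ha ih =>
    have has : a ∉ s := fun h => lt_irrefl _ (ha a h)
    have hf' : MonotoneOn f s := hf.mono (by simp)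
    have hmin : ∀ x ∈ (insert a s).val.map f, f a ≤ x := by
      intro x hx
      obtain ⟨y, hy, rfl⟩ := Multiset.mem_map.1 hx
      rcases Finset.mem_insert.1 (Finset.mem_def.2 hy) with rfl | hy'
      · exact le_rfl
      · exact hf (by simp) (by simp [hy']) (ha y hy').le
    have hins : (insert a s).val.map f = f a ::ₘ s.val.map f := by
      rw [Finset.insert_val_of_notMem has, Multiset.map_cons]
    rw [Finset.sum_powerset_insert has]
    have e1 : ∀ P ∈ s.powerset, (if P.val.map f = R ∧ (insert a s \ P).val.map f = U then
          q ^ splitInv (insert a s) P else 0) =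
        if f a ∈ U then q ^ R.card * (if P.val.map f = R ∧ (s \ P).val.map f = U.erase (f a) then
          q ^ splitInv s P else 0) else 0 := by
      intro P hP
      have hPs := Finset.mem_powerset.1 hP
      have haP : a ∉ P := fun h => has (hPs h)
      rw [splitInv_insert_of_lt ha hPs, Finset.insert_sdiff_of_notMem _ haP,
        Finset.insert_val_of_notMem (fun h => has (Finset.mem_sdiff.1 h).1), Multiset.map_cons]
      by_cases hU : f a ∈ U
      · rw [if_pos hU]
        obtain ⟨U, rfl⟩ := Multiset.exists_cons_of_mem hU
        simp only [Multiset.cons_inj_right, Multiset.erase_cons_head]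
        split_ifs with hc
        · rw [← hc.1, Multiset.card_map, pow_add]; rfl
        · rw [mul_zero]
      · rw [if_neg hU, if_neg]
        rintro ⟨-, rfl⟩
        exact hU (Multiset.mem_cons_self _ _)
    have e2 : ∀ P ∈ s.powerset, (if (insert a P).val.map f = R ∧
          (insert a s \ insert a P).val.map f = U then
          q ^ splitInv (insert a s) (insert a P) else 0) =
        if f a ∈ R then (if P.val.map f = R.erase (f a) ∧ (s \ P).val.map f = U then
          q ^ splitInv s P else 0) else 0 := by
      intro P hP
      have haP : a ∉ P := fun h => has (Finset.mem_powerset.1 hP h)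
      rw [splitInv_insert_insert ha, Finset.insert_sdiff_insert, Finset.sdiff_insert_of_notMem has,
        Finset.insert_val_of_notMem haP, Multiset.map_cons]
      by_cases hR : f a ∈ R
      · rw [if_pos hR]
        obtain ⟨R, rfl⟩ := Multiset.exists_cons_of_mem hR
        simp only [Multiset.cons_inj_right, Multiset.erase_cons_head]
      · rw [if_neg hR, if_neg]
        rintro ⟨rfl, -⟩
        exact hR (Multiset.mem_cons_self _ _)
    rw [Finset.sum_congr rfl e1, Finset.sum_congr rfl e2]
    have e3 : f a ∈ U → (s.val.map f = R + U.erase (f a) ↔ (insert a s).val.map f = R + U) := by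
      intro hU
      obtain ⟨U, rfl⟩ := Multiset.exists_cons_of_mem hU
      rw [hins, Multiset.add_cons, Multiset.cons_inj_right, Multiset.erase_cons_head]
    have e4 : f a ∈ R → (s.val.map f = R.erase (f a) + U ↔ (insert a s).val.map f = R + U) := by
      intro hR
      obtain ⟨R, rfl⟩ := Multiset.exists_cons_of_mem hR
      rw [hins, Multiset.cons_add, Multiset.cons_inj_right, Multiset.erase_cons_head]
    by_cases hc : (insert a s).val.map f = R + U
    · rw [if_pos hc, splitWeight_rec q (j := f a) (by rw [← hc, hins]; simp)
        (by rw [← hc]; exact hmin)]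
      congr 1
      · split_ifs with hU
        · rw [← Finset.mul_sum, ih hf', if_pos ((e3 hU).2 hc)]
        · exact Finset.sum_const_zero
      · split_ifs with hR
        · rw [ih hf', if_pos ((e4 hR).2 hc)]
        · exact Finset.sum_const_zero
    · rw [if_neg hc]
      have z1 : (∑ P ∈ s.powerset, if f a ∈ U then q ^ R.card *
          (if P.val.map f = R ∧ (s \ P).val.map f = U.erase (f a) then
          q ^ splitInv s P else 0) else 0) = 0 := by
        split_ifs with hU
        · rw [← Finset.mul_sum, ih hf', if_neg (fun h => hc ((e3 hU).1 h)), mul_zero]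
        · exact Finset.sum_const_zero
      have z2 : (∑ P ∈ s.powerset, if f a ∈ R then
          (if P.val.map f = R.erase (f a) ∧ (s \ P).val.map f = U then
          q ^ splitInv s P else 0) else 0) = 0 := by
        split_ifs with hR
        · rw [ih hf', if_neg (fun h => hc ((e4 hR).1 h))]
        · exact Finset.sum_const_zero
      rw [z1, z2, add_zero]

end QBinomial

section Contents

variable {n : ℕ} {β : Type*}

/-- The multiset of letters of the word `f` in the positions `k` with `ρ k = r`. -/
def content (ρ : Fin n → β) (f : Fin n → ℕ) (r : β) : Multiset ℕ :=
  (Finset.univ.filter fun k => ρ k = r).val.map f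

theorem content_eq_map {ρ : Fin n → β} {r : β} {P : Finset (Fin n)} (h : ∀ k, ρ k = r ↔ k ∈ P)
    (f : Fin n → ℕ) : content ρ f r = P.val.map f := by
  unfold content
  congr 2
  ext k
  rw [Finset.mem_filter, h]
  exact and_iff_right (Finset.mem_univ k)

theorem content_comp_comp (ρ : Fin n → β) (f : Fin n → ℕ) (σ : Equiv.Perm (Fin n)) :
    content (ρ ∘ σ) (f ∘ σ) = content ρ f := by
  funext r
  unfold content
  have h : (Finset.univ.filter fun k => (ρ ∘ σ) k = r).map σ.toEmbedding =
      Finset.univ.filter fun k => ρ k = r := by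
    ext k
    simp only [Finset.mem_map_equiv, Finset.mem_filter, Finset.mem_univ, true_and,
      Function.comp_apply, Equiv.apply_symm_apply]
  rw [← h, Finset.map_val, Multiset.map_map]
  rfl

theorem count_content (ρ : Fin n → β) (f : Fin n → ℕ) (r : β) (v : ℕ) :
    (content ρ f r).count v = (Finset.univ.filter fun k => (ρ k, f k) = (r, v)).card := by
  unfold content
  rw [Multiset.count_map, ← Finset.filter_val, Finset.filter_filter]
  simp only [Prod.mk.injEq, eq_comm (a := v)]
  rfl

theorem exists_perm_comp_eq {γ : Type*} (a b : Fin n → γ)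
    (h : ∀ x, (Finset.univ.filter fun k => a k = x).card =
      (Finset.univ.filter fun k => b k = x).card) :
    ∃ σ : Equiv.Perm (Fin n), a ∘ σ = b := by
  have e : ∀ x, Nonempty ({k // b k = x} ≃ {k // a k = x}) := fun x => by
    refine ⟨Fintype.equivOfCardEq ?_⟩
    rw [Fintype.card_subtype, Fintype.card_subtype, h]
  refine ⟨(Equiv.sigmaFiberEquiv b).symm.trans ((Equiv.sigmaCongrRight fun x => (e x).some).trans
    (Equiv.sigmaFiberEquiv a)), funext fun k => ?_⟩
  exact ((e (b k)).some ⟨k, rfl⟩).2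

theorem content_eq_iff (ρ : Fin n → β) (f f' : Fin n → ℕ) :
    content ρ f = content ρ f' ↔ ∃ σ : Equiv.Perm (Fin n), ρ ∘ σ = ρ ∧ f ∘ σ = f' := by
  constructor
  · intro h
    obtain ⟨σ, hσ⟩ := exists_perm_comp_eq (fun k => (ρ k, f k)) (fun k => (ρ k, f' k)) fun x => by
      have h' := (count_content ρ f x.1 x.2).symm.trans (h ▸ count_content ρ f' x.1 x.2)
      convert h'
    exact ⟨σ, funext fun k => congrArg Prod.fst (congrFun hσ k),
      funext fun k => congrArg Prod.snd (congrFun hσ k)⟩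
  · rintro ⟨σ, hρ, rfl⟩
    conv_rhs => rw [← hρ]
    rw [content_comp_comp]

/-- The word recording which row of `t^λ w` contains each entry. -/
def rowWord (lam : ℕ → ℕ) (w : Equiv.Perm (Fin n)) : Fin n → ℕ := fun k => rowOf lam (w⁻¹ k)

theorem rowWord_mul (lam : ℕ → ℕ) (σ w : Equiv.Perm (Fin n)) :
    rowWord lam (σ⁻¹ * w) = rowWord lam w ∘ σ := by
  funext k
  simp only [rowWord, mul_inv_rev, inv_inv, Equiv.Perm.mul_apply, Function.comp_apply]

theorem rowWord_adjT_mul (lam : ℕ → ℕ) (i : ℕ) (h : i + 1 < n) (w : Equiv.Perm (Fin n)) :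
    rowWord lam (adjT i h * w) = rowWord lam w ∘ adjT i h := by
  rw [← rowWord_mul, adjT_inv]

theorem mem_doubleCoset_iff (lam mu : ℕ → ℕ) (d w : Equiv.Perm (Fin n)) :
    w ∈ doubleCoset lam mu d ↔
      content (fun k : Fin n => rowOf mu k) (rowWord lam w) =
        content (fun k : Fin n => rowOf mu k) (rowWord lam d) := by
  rw [content_eq_iff]
  constructor
  · rintro ⟨u, hu, v, hv, rfl⟩
    refine ⟨v, funext fun k => hv k, funext fun k => ?_⟩
    simp only [rowWord, Function.comp_apply]
    rw [← hu]
    simp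
  · rintro ⟨v, hv, hw⟩
    refine ⟨d⁻¹ * v⁻¹ * w, fun p => ?_, v, fun p => congrFun hv p, by group⟩
    have h := congrFun hw (v⁻¹ (w p))
    simp only [rowWord, Function.comp_apply] at h
    simpa [Equiv.Perm.mul_apply] using h.symm

end Contents

section Coefficients

variable {F : Type*} [Field F] {H : Type*} [Ring H] [Algebra F H] {n : ℕ}
variable {q : F} {T : Equiv.Perm (Fin n) → H}

namespace IsHeckeBasis

theorem coef_sum_T (hT : IsHeckeBasis q T) (P : Equiv.Perm (Fin n) → Prop)
    (w : Equiv.Perm (Fin n)) :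
    hT.coef w (∑ v ∈ Finset.univ.filter P, T v) = if P w then 1 else 0 := by
  rw [map_sum]
  simp only [coef_T]
  rw [Finset.sum_ite_eq']
  simp

theorem mul_adj_eq_smul_iff (hT : IsHeckeBasis q T) (hq : q ≠ 0) {X : H} {i : ℕ}
    {h : i + 1 < n} :
    X * T (adjT i h) = q • X ↔ ∀ w, hT.coef (adjT i h * w) X = hT.coef w X := by
  constructor
  · intro hX
    have key : ∀ w, Asc w i h → hT.coef (adjT i h * w) X = hT.coef w X := fun w hw => by
      have := hT.coef_mul_adj X w i h
      rw [if_pos hw, hX, map_smul, smul_eq_mul] at this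
      exact (mul_left_cancel₀ hq this).symm
    intro w
    by_cases hw : Asc w i h
    · exact key w hw
    · have := key _ (asc_adjT_mul hw)
      rw [adjT_mul_cancel] at this
      exact this.symm
  · intro hX
    refine hT.ext_coef fun w => ?_
    rw [hT.coef_mul_adj, hX, map_smul, smul_eq_mul]
    split_ifs <;> ring

end IsHeckeBasis

end Coefficients

section SplitWords

variable {n : ℕ}

theorem permLength_sort {α : Type*} [LinearOrder α] (g : Fin n → α) :
    permLength (Tuple.sort g) =
      (Finset.univ.filter fun p : Fin n × Fin n => p.1 < p.2 ∧ g p.2 < g p.1).card := by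
  rw [← permLength_inv, permLength]
  congr 1
  refine Finset.filter_congr fun p _ => and_congr_right fun hp => ?_
  rw [sort_inv_lt_iff]
  exact or_iff_left fun h => hp.not_gt h.2

/-- The positions before `m`. -/
def loPos (n m : ℕ) : Finset (Fin n) := Finset.univ.filter fun k => (k : ℕ) < m

/-- The positions from `m` on. -/
def hiPos (n m : ℕ) : Finset (Fin n) := Finset.univ.filter fun k => m ≤ (k : ℕ)

theorem mem_loPos {m : ℕ} {k : Fin n} : k ∈ loPos n m ↔ (k : ℕ) < m := by simp [loPos]

theorem mem_hiPos {m : ℕ} {k : Fin n} : k ∈ hiPos n m ↔ m ≤ (k : ℕ) := by simp [hiPos]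

/-- The word with letter `0` in the positions of `P`, `2` in those of `hiPos n m \ Q`, and `1`
elsewhere. -/
def splitWord (m : ℕ) (P Q : Finset (Fin n)) (k : Fin n) : Fin 3 :=
  if (k : ℕ) < m then (if k ∈ P then 0 else 1) else if k ∈ Q then 1 else 2

/-- The words whose letters before position `m` are `0` or `1`, and `1` or `2` from `m` on. -/
def splitWords (n m : ℕ) : Finset (Fin n → Fin 3) :=
  Finset.univ.filter fun g => ∀ k : Fin n, ((k : ℕ) < m → g k ≠ 2) ∧ (m ≤ (k : ℕ) → g k ≠ 0)

theorem mem_splitWords {m : ℕ} {g : Fin n → Fin 3} : g ∈ splitWords n m ↔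
    ∀ k : Fin n, ((k : ℕ) < m → g k ≠ 2) ∧ (m ≤ (k : ℕ) → g k ≠ 0) := by simp [splitWords]

theorem permLength_sort_splitWord {m : ℕ} {P Q : Finset (Fin n)} (hP : P ⊆ loPos n m)
    (hQ : Q ⊆ hiPos n m) :
    permLength (Tuple.sort (splitWord m P Q)) =
      splitInv (loPos n m) P + splitInv (hiPos n m) Q := by
  rw [permLength_sort, splitInv, splitInv, ← Finset.card_union_of_disjoint]
  · congr 1
    ext ⟨k, l⟩
    simp only [Finset.mem_filter, Finset.mem_univ, true_and, Finset.mem_union, Finset.mem_product,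
      Finset.mem_sdiff, mem_loPos, mem_hiPos, splitWord, Fin.lt_def]
    have hk : k ∈ P → (k : ℕ) < m := fun h => mem_loPos.1 (hP h)
    have hl : l ∈ P → (l : ℕ) < m := fun h => mem_loPos.1 (hP h)
    have hk' : k ∈ Q → m ≤ (k : ℕ) := fun h => mem_hiPos.1 (hQ h)
    have hl' : l ∈ Q → m ≤ (l : ℕ) := fun h => mem_hiPos.1 (hQ h)
    by_cases h1 : (k : ℕ) < m <;> by_cases h2 : (l : ℕ) < m <;> by_cases h3 : k ∈ P <;>
      by_cases h4 : l ∈ P <;> by_cases h5 : k ∈ Q <;> by_cases h6 : l ∈ Q <;>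
      simp [h1, h2, h3, h4, h5, h6] <;> first | omega | simp_all
  · rw [Finset.disjoint_left]
    rintro ⟨x, y⟩ hx hy
    simp only [Finset.mem_filter, Finset.mem_product, Finset.mem_sdiff, mem_loPos, mem_hiPos]
      at hx hy
    omega

theorem sum_splitWords {M : Type*} [AddCommMonoid M] (m : ℕ) (F : (Fin n → Fin 3) → M) :
    ∑ g ∈ splitWords n m, F g =
      ∑ P ∈ (loPos n m).powerset, ∑ Q ∈ (hiPos n m).powerset, F (splitWord m P Q) := by
  rw [← Finset.sum_product']
  refine Finset.sum_nbij' (fun g => ((loPos n m).filter fun k => g k = 0,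
    (hiPos n m).filter fun k => g k = 1)) (fun p => splitWord m p.1 p.2) ?_ ?_ ?_ ?_ ?_
  · intro g _
    exact Finset.mem_product.2 ⟨Finset.mem_powerset.2 (Finset.filter_subset _ _),
      Finset.mem_powerset.2 (Finset.filter_subset _ _)⟩
  · intro p _
    rw [mem_splitWords]
    intro k
    unfold splitWord
    refine ⟨fun h => ?_, fun h => ?_⟩
    · rw [if_pos h]; split_ifs <;> decide
    · rw [if_neg (not_lt.2 h)]; split_ifs <;> decide
  · intro g hg
    have hg := mem_splitWords.1 hg
    funext k
    obtain ⟨h1, h2⟩ := hg k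
    simp only [splitWord, Finset.mem_filter, mem_loPos, mem_hiPos]
    have h3 : ∀ x : Fin 3, x = 0 ∨ x = 1 ∨ x = 2 := by decide
    by_cases hk : (k : ℕ) < m
    · rcases h3 (g k) with h | h | h <;> simp_all
    · rcases h3 (g k) with h | h | h <;> simp_all
  · rintro ⟨P, Q⟩ hp
    obtain ⟨hP, hQ⟩ := Finset.mem_product.1 hp
    have hP := Finset.mem_powerset.1 hP
    have hQ := Finset.mem_powerset.1 hQ
    refine Prod.ext ?_ ?_
    · ext k
      simp only [splitWord, Finset.mem_filter, mem_loPos]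
      constructor
      · rintro ⟨h, h'⟩
        rw [if_pos h] at h'
        by_contra hk
        simp [hk] at h'
      · intro hk
        have h := mem_loPos.1 (hP hk)
        simp [h, hk]
    · ext k
      simp only [splitWord, Finset.mem_filter, mem_hiPos]
      constructor
      · rintro ⟨h, h'⟩
        rw [if_neg (not_lt.2 h)] at h'
        by_contra hk
        simp [hk] at h'
      · intro hk
        have h := mem_hiPos.1 (hQ hk)
        simp [h, hk, not_lt.2 h]
  · intro g hg
    have hg := mem_splitWords.1 hg
    congr 1
    funext k
    obtain ⟨h1, h2⟩ := hg k
    simp only [splitWord, Finset.mem_filter, mem_loPos, mem_hiPos]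
    have h3 : ∀ x : Fin 3, x = 0 ∨ x = 1 ∨ x = 2 := by decide
    by_cases hk : (k : ℕ) < m
    · rcases h3 (g k) with h | h | h <;> simp_all
    · rcases h3 (g k) with h | h | h <;> simp_all

theorem content_splitWord_zero {m : ℕ} {P Q : Finset (Fin n)} (hP : P ⊆ loPos n m)
    (f : Fin n → ℕ) : content (splitWord m P Q) f 0 = P.val.map f := by
  refine content_eq_map (fun k => ?_) f
  unfold splitWord
  have hk : k ∈ P → (k : ℕ) < m := fun h => mem_loPos.1 (hP h)
  split_ifs with h1 h2 h2 <;> simp_all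

theorem content_splitWord_one {m : ℕ} {P Q : Finset (Fin n)} (hQ : Q ⊆ hiPos n m)
    (f : Fin n → ℕ) :
    content (splitWord m P Q) f 1 = (loPos n m \ P).val.map f + Q.val.map f := by
  have hd : Disjoint (loPos n m \ P) Q := by
    rw [Finset.disjoint_left]
    intro k h1 h2
    exact (mem_loPos.1 (Finset.mem_sdiff.1 h1).1).not_ge (mem_hiPos.1 (hQ h2))
  rw [← Multiset.map_add, ← Finset.disjUnion_val _ _ hd]
  refine content_eq_map (fun k => ?_) f
  rw [Finset.mem_disjUnion, Finset.mem_sdiff, mem_loPos, splitWord]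
  have hk : k ∈ Q → m ≤ (k : ℕ) := fun h => mem_hiPos.1 (hQ h)
  split_ifs with h1 h2 h2 <;> simp_all
  exact fun h => (hk h).not_gt h1

theorem content_splitWord_two {m : ℕ} {P Q : Finset (Fin n)}
    (f : Fin n → ℕ) : content (splitWord m P Q) f 2 = (hiPos n m \ Q).val.map f := by
  refine content_eq_map (fun k => ?_) f
  rw [Finset.mem_sdiff, mem_hiPos, splitWord]
  split_ifs with h1 h2 h2 <;> simp_all

theorem card_loPos {m : ℕ} (hm : m ≤ n) : (loPos n m).card = m := by
  have : (loPos n m).map Fin.valEmbedding = Finset.range m := by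
    ext k
    simp only [Finset.mem_map, mem_loPos, Fin.valEmbedding_apply, Finset.mem_range]
    exact ⟨fun ⟨a, h, e⟩ => e ▸ h, fun h => ⟨⟨k, by omega⟩, h, rfl⟩⟩
  rw [← Finset.card_map, this, Finset.card_range]

/-- The generating function of the splittings of a word `f` that is increasing on both rows. -/
theorem sum_splitWords_content {F : Type*} [Field F] (q : F) {m : ℕ} (hm : m ≤ n) (f : Fin n → ℕ)
    (hlo : MonotoneOn f (loPos n m : Set (Fin n))) (hhi : MonotoneOn f (hiPos n m : Set (Fin n)))
    (R S V : Multiset ℕ) :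
    (∑ g ∈ splitWords n m, if content g f = ![R, S, V] then q ^ permLength (Tuple.sort g) else 0) =
      ∑ U ∈ S.powerset.toFinset.filter (fun U => U.card + R.card = m),
        (qBinomProd q R U * qBinomProd q V (S - U) * q ^ (invPairs R U + invPairs (S - U) V)) *
          if (loPos n m).val.map f = R + U ∧ (hiPos n m).val.map f = V + (S - U) then 1 else 0 := by
  set E := S.powerset.toFinset.filter (fun U => U.card + R.card = m) with hE
  have hterm : ∀ P ∈ (loPos n m).powerset, ∀ Q ∈ (hiPos n m).powerset,
      (if content (splitWord m P Q) f = ![R, S, V] then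
        q ^ permLength (Tuple.sort (splitWord m P Q)) else 0) =
      ∑ U ∈ E, (if P.val.map f = R ∧ (loPos n m \ P).val.map f = U then
          q ^ splitInv (loPos n m) P else 0) *
        (if Q.val.map f = S - U ∧ (hiPos n m \ Q).val.map f = V then
          q ^ splitInv (hiPos n m) Q else 0) := by
    intro P hP Q hQ
    have hP := Finset.mem_powerset.1 hP
    have hQ := Finset.mem_powerset.1 hQ
    have hc : content (splitWord m P Q) f = ![R, S, V] ↔ P.val.map f = R ∧
        (loPos n m \ P).val.map f + Q.val.map f = S ∧ (hiPos n m \ Q).val.map f = V := by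
      rw [funext_iff, Fin.forall_fin_succ, Fin.forall_fin_two, ← content_splitWord_zero hP f,
        ← content_splitWord_one hQ f, ← content_splitWord_two (P := P) f]
      rfl
    rw [permLength_sort_splitWord hP hQ]
    by_cases h : content (splitWord m P Q) f = ![R, S, V]
    · rw [if_pos h]
      obtain ⟨h0, h1, h2⟩ := hc.1 h
      have hcard : (loPos n m \ P).card + P.card = m := by
        rw [Finset.card_sdiff_add_card_eq_card hP, card_loPos hm]
      rw [Finset.sum_eq_single ((loPos n m \ P).val.map f)]
      · rw [if_pos ⟨h0, rfl⟩, if_pos ⟨by rw [← h1, add_tsub_cancel_left], h2⟩, pow_add]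
      · intro U _ hU
        rw [if_neg fun h' => hU h'.2.symm, zero_mul]
      · intro hn
        refine absurd ?_ hn
        rw [hE, Finset.mem_filter, Multiset.mem_toFinset, Multiset.mem_powerset, ← h1, ← h0,
          Multiset.card_map, Multiset.card_map]
        exact ⟨Multiset.le_add_right _ _, hcard⟩
    · rw [if_neg h]
      refine (Finset.sum_eq_zero fun U hU => ?_).symm
      rw [hE, Finset.mem_filter, Multiset.mem_toFinset, Multiset.mem_powerset] at hU
      by_cases h1 : P.val.map f = R ∧ (loPos n m \ P).val.map f = U
      · rw [if_neg (c := Q.val.map f = S - U ∧ _), mul_zero]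
        rintro ⟨h2, h3⟩
        refine h (hc.2 ⟨h1.1, ?_, h3⟩)
        rw [h1.2, h2, add_tsub_cancel_of_le hU.1]
      · rw [if_neg h1, zero_mul]
  rw [sum_splitWords, Finset.sum_congr rfl fun P hP => Finset.sum_congr rfl fun Q hQ =>
    hterm P hP Q hQ]
  rw [Finset.sum_congr rfl fun P _ => Finset.sum_comm, Finset.sum_comm]
  refine Finset.sum_congr rfl fun U _ => ?_
  simp only [← Finset.mul_sum, ← Finset.sum_mul]
  rw [sum_split q _ f hlo, sum_split q _ f hhi, splitWeight, splitWeight, qBinomProd_symm q V,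
    add_comm V]
  by_cases h1 : (loPos n m).val.map f = R + U <;>
    by_cases h2 : (hiPos n m).val.map f = S - U + V <;> simp only [h1, h2, if_true, if_false,
      and_true, and_false, mul_zero, zero_mul]
  ring

end SplitWords

section Rows

theorem cumSum_mono (lam : ℕ → ℕ) : Monotone (cumSum lam) := fun _ _ h =>
  Finset.sum_le_sum_of_subset (Finset.range_subset_range.2 h)

theorem rowOf_eq {lam : ℕ → ℕ} {p r : ℕ} (h1 : cumSum lam r ≤ p) (h2 : p < cumSum lam (r + 1)) :
    rowOf lam p = r := by
  refine le_antisymm (Nat.sInf_le h2) (le_csInf ⟨r, h2⟩ fun r' hr' => ?_)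
  by_contra hlt
  exact absurd (h1.trans_lt hr') (not_lt.2 (cumSum_mono lam (by omega)))

theorem rowOf_mono {lam : ℕ → ℕ} {a b N : ℕ} (hab : a ≤ b) (hb : b < cumSum lam N) :
    rowOf lam a ≤ rowOf lam b := by
  have hne : {r | b < cumSum lam (r + 1)}.Nonempty :=
    ⟨N, hb.trans_le (cumSum_mono lam (Nat.le_succ N))⟩
  exact Nat.sInf_le (hab.trans_lt (Nat.sInf_mem hne))

theorem rowOf_eq_iff {lam : ℕ → ℕ} {p r N : ℕ} (hp : p < cumSum lam N) :
    rowOf lam p = r ↔ cumSum lam r ≤ p ∧ p < cumSum lam (r + 1) := by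
  refine ⟨?_, fun h => rowOf_eq h.1 h.2⟩
  rintro rfl
  have hne : {r | p < cumSum lam (r + 1)}.Nonempty :=
    ⟨N, hp.trans_le (cumSum_mono lam (Nat.le_succ N))⟩
  refine ⟨?_, Nat.sInf_mem hne⟩
  rcases h : rowOf lam p with _ | r
  · exact Nat.zero_le _
  · by_contra hlt
    have : r ∉ {r | p < cumSum lam (r + 1)} := Nat.notMem_of_lt_sInf (by
      change r < rowOf lam p
      omega)
    exact this (not_le.1 hlt)

theorem rowOf_comp2 {a b p : ℕ} (hp : p < a + b) :
    rowOf (comp2 a b) p = if p < a then 0 else 1 := by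
  split_ifs with h <;> refine rowOf_eq ?_ ?_ <;> simp [cumSum, Finset.sum_range_succ, comp2] <;>
    omega

theorem conjP_comp2 {a b : ℕ} (hba : b ≤ a) (i : ℕ) :
    conjP (comp2 a b) i = if i < b then 2 else if i < a then 1 else 0 := by
  unfold conjP
  have hmem : ∀ r, r ∈ {r | comp2 a b r ≤ i} ↔ comp2 a b r ≤ i := fun _ => Iff.rfl
  split_ifs with h1 h2
  · refine le_antisymm (Nat.sInf_le (by simp [comp2])) (le_csInf ⟨2, by simp [comp2]⟩ ?_)
    intro r hr
    rw [hmem, comp2] at hr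
    split_ifs at hr <;> omega
  · refine le_antisymm (Nat.sInf_le (by simp [comp2]; omega))
      (le_csInf ⟨1, by simp [comp2]; omega⟩ ?_)
    intro r hr
    rw [hmem, comp2] at hr
    split_ifs at hr <;> omega
  · exact Nat.le_zero.1 (Nat.sInf_le (by simp [comp2]; omega))

theorem cumSum_conjP_comp2 {a b : ℕ} (hba : b ≤ a) {i : ℕ} (hi : i ≤ a) :
    cumSum (conjP (comp2 a b)) i = if i ≤ b then 2 * i else i + b := by
  induction i with
  | zero => simp [cumSum]
  | succ i ih =>
    rw [cumSum, Finset.sum_range_succ, ← cumSum, ih (by omega), conjP_comp2 hba]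
    split_ifs <;> omega

theorem rowOf_conjP_comp2 {a b p : ℕ} (hba : b ≤ a) (hp : p < a + b) :
    rowOf (conjP (comp2 a b)) p = if p < 2 * b then p / 2 else p - b := by
  split_ifs with h <;> refine rowOf_eq ?_ ?_ <;> rw [cumSum_conjP_comp2 hba (by omega)] <;>
    split_ifs <;> omega

/-- Among more than `a` cells of a two-row diagram with rows `a ≥ b`, two lie in the same
column. -/
theorem exists_adjacent_of_card_lt {n a b : ℕ} (hba : b ≤ a) (hn : a + b = n) (s : Finset (Fin n))
    (hs : a < s.card) : ∃ (i : ℕ) (h : i + 1 < n),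
      rowOf (conjP (comp2 a b)) i = rowOf (conjP (comp2 a b)) (i + 1) ∧
        ⟨i, Nat.lt_of_succ_lt h⟩ ∈ s ∧ ⟨i + 1, h⟩ ∈ s := by
  obtain ⟨k, hk, l, hl, hne, he⟩ := Finset.exists_ne_map_eq_of_card_lt_of_maps_to
    (s := s) (t := Finset.range a) (f := fun k => rowOf (conjP (comp2 a b)) k)
    (by rwa [Finset.card_range]) (fun k _ => by
      have := k.2
      simp only [Finset.coe_range, Set.mem_Iio]
      rw [rowOf_conjP_comp2 hba (by omega)]
      split_ifs <;> omega)
  wlog hkl : k < l generalizing k l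
  · exact this l hl k hk hne.symm he.symm (lt_of_le_of_ne (not_lt.1 hkl) hne.symm)
  have h1 := k.2
  have h2 := l.2
  rw [Fin.lt_def] at hkl
  have hl1 : (l : ℕ) = k + 1 := by
    simp only [rowOf_conjP_comp2 hba (show (k : ℕ) < a + b by omega),
      rowOf_conjP_comp2 hba (show (l : ℕ) < a + b by omega)] at he
    split_ifs at he <;> omega
  refine ⟨k, hl1 ▸ h2, ?_, hk, ?_⟩
  · rw [← hl1]; exact he
  · convert hl using 1
    exact Fin.ext hl1.symm

theorem exists_card_lt_cumSum {lam : ℕ → ℕ} {A : Multiset ℕ} (h : ∀ v, lam v = A.count v) :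
    ∃ N, cumSum lam N = A.card := by
  refine ⟨A.toFinset.sup id + 1, ?_⟩
  rw [← Multiset.toFinset_sum_count_eq A, cumSum, Finset.sum_congr rfl fun v _ => h v]
  refine (Finset.sum_subset (fun v hv => ?_) fun v _ hv => ?_).symm
  · exact Finset.mem_range.2 (Nat.lt_succ_of_le (Finset.le_sup (f := id) hv))
  · exact Multiset.count_eq_zero.2 fun hm => hv (Multiset.mem_toFinset.2 hm)

variable {n : ℕ}

theorem map_getD_sort (A : Multiset ℕ) (a : ℕ) (s : Finset (Fin n)) (hn : a + A.card ≤ n)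
    (hs : ∀ k : Fin n, k ∈ s ↔ a ≤ (k : ℕ) ∧ (k : ℕ) < a + A.card) :
    (s.val.map fun k : Fin n => (A.sort (· ≤ ·)).getD ((k : ℕ) - a) 0) = A := by
  set l := A.sort (· ≤ ·) with hl
  have hlen : l.length = A.card := Multiset.length_sort _
  let e : Fin l.length ↪ Fin n :=
    ⟨fun i => ⟨a + i, by have := i.2; omega⟩, fun i j h => by
      have := congrArg Fin.val h
      exact Fin.ext (by simpa using this)⟩
  have he : ∀ i, ((e i : Fin n) : ℕ) = a + i := fun _ => rfl
  have hse : s = Finset.univ.map e := by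
    ext k
    rw [hs, Finset.mem_map]
    constructor
    · rintro ⟨h1, h2⟩
      exact ⟨⟨(k : ℕ) - a, by omega⟩, Finset.mem_univ _, Fin.ext (Nat.add_sub_cancel' h1)⟩
    · rintro ⟨i, -, rfl⟩
      have := i.2
      rw [he]
      omega
  rw [hse, Finset.map_val, Multiset.map_map, Fin.univ_val_map]
  have : (List.ofFn ((fun k : Fin n => l.getD ((k : ℕ) - a) 0) ∘ e)) = l := by
    conv_rhs => rw [← List.ofFn_get l]
    congr 1
    funext i
    simp [he]
  rw [this, hl, Multiset.sort_eq]

theorem content_rowWord_eq {mu lam : ℕ → ℕ} {A : ℕ → Multiset ℕ} {d : Equiv.Perm (Fin n)}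
    (hd : Is1A mu lam A d) {r : ℕ} (hr : (A r).card = mu r) {N : ℕ} (hN : cumSum mu N = n)
    (hn : cumSum mu (r + 1) ≤ n) :
    content (fun k : Fin n => rowOf mu k) (rowWord lam d) r = A r := by
  have hc : cumSum mu (r + 1) = cumSum mu r + mu r := Finset.sum_range_succ _ _
  have h := map_getD_sort (A r) (cumSum mu r)
    (Finset.univ.filter fun k : Fin n => rowOf mu k = r) (by omega) fun k => by
      rw [Finset.mem_filter, hr, ← hc, rowOf_eq_iff (k.2.trans_eq hN.symm)]
      exact and_iff_right (Finset.mem_univ k)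
  rw [content_eq_map (P := Finset.univ.filter fun k : Fin n => rowOf mu k = r) (by simp)]
  conv_rhs => rw [← h]
  refine Multiset.map_congr rfl fun k hk => ?_
  have hk : rowOf mu k = r := (Finset.mem_filter.1 (Finset.mem_def.2 hk)).2
  have := hd.2 (d⁻¹ k)
  simp only [Equiv.Perm.coe_inv, Equiv.apply_symm_apply, hk] at this
  exact this.symm

end Rows

section TwoRow

variable {F : Type*} [Field F] {H : Type*} [Ring H] [Algebra F H] {n : ℕ}
variable {q : F} {T : Equiv.Perm (Fin n) → H}

/-- Induction from the permutations whose inverse increases on both sides of `m`. -/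
theorem two_row_induction (m : ℕ) {P : Equiv.Perm (Fin n) → Prop}
    (base : ∀ w : Equiv.Perm (Fin n), (∀ k l : Fin n, k < l → ((l : ℕ) < m ∨ m ≤ (k : ℕ)) →
      w⁻¹ k < w⁻¹ l) → P w)
    (step : ∀ w i h, i + 1 ≠ m → P w → P (adjT i h * w)) (w : Equiv.Perm (Fin n)) : P w := by
  induction hl : permLength w using Nat.strong_induction_on generalizing w with
  | _ l ih =>
    by_cases hw : ∀ i h, i + 1 ≠ m → Asc w i h
    · exact base w fun k l hkl hm => lt_of_forall_adj _ hkl fun i h _ _ => hw i h (by omega)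
    · push Not at hw
      obtain ⟨i, h, him, hi⟩ := hw
      have hlt := permLength_adjT_mul_lt hi
      have := step _ i h him (ih (permLength (adjT i h * w)) (by omega) _ rfl)
      rwa [adjT_mul_cancel] at this

/-- The sum of the `T_w` for which the rows of `t^λ w` containing the letters in each block of
`g₀` have the prescribed content. -/
def contentSum {β : Type*} (T : Equiv.Perm (Fin n) → H) (lam : ℕ → ℕ) (g₀ : Fin n → β)
    (C : β → Multiset ℕ) : H :=
  ∑ w ∈ Finset.univ.filter (fun w => content g₀ (rowWord lam w) = C), T w

theorem comp_sort_eq_of_content {α : Type*} [LinearOrder α] {g₀ g : Fin n → α}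
    {C : α → Multiset ℕ} (hmono : Monotone g₀)
    (hg₀ : ∀ c, (Finset.univ.filter fun k => g₀ k = c).card = (C c).card) {f : Fin n → ℕ}
    (hg : content g f = C) : g ∘ Tuple.sort g = g₀ := by
  obtain ⟨σ, rfl⟩ := exists_perm_comp_eq g₀ g fun c => by
    have h := hg₀ c
    rw [← hg, content, Multiset.card_map] at h
    convert h
    rfl
  rw [Tuple.comp_perm_comp_sort_eq_comp_sort, Tuple.sort_eq_refl_iff_monotone.2 hmono]
  rfl

namespace IsHeckeBasis

theorem contentSum_mul_adj {β : Type*} (hT : IsHeckeBasis q T) (hq : q ≠ 0) (lam : ℕ → ℕ)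
    {g₀ : Fin n → β} (C : β → Multiset ℕ) (i : ℕ) (h : i + 1 < n)
    (hg : g₀ ⟨i, Nat.lt_of_succ_lt h⟩ = g₀ ⟨i + 1, h⟩) :
    contentSum T lam g₀ C * T (adjT i h) = q • contentSum T lam g₀ C := by
  rw [hT.mul_adj_eq_smul_iff hq]
  intro w
  rw [contentSum, hT.coef_sum_T, hT.coef_sum_T, rowWord_adjT_mul]
  conv_rhs => rw [← content_comp_comp g₀ _ (adjT i h), comp_adjT_of_eq hg]

theorem XPhi_mul_adj (hT : IsHeckeBasis q T) (hq : q ≠ 0) (lam mu : ℕ → ℕ)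
    (d : Equiv.Perm (Fin n)) (i : ℕ) (h : i + 1 < n) (hi : rowOf mu i = rowOf mu (i + 1)) :
    XPhi T lam mu d * T (adjT i h) = q • XPhi T lam mu d := by
  have : XPhi T lam mu d = contentSum T lam (fun k : Fin n => rowOf mu k)
      (content (fun k : Fin n => rowOf mu k) (rowWord lam d)) := by
    unfold XPhi contentSum
    refine Finset.sum_congr (Finset.filter_congr fun w _ => ?_) fun _ _ => rfl
    exact mem_doubleCoset_iff lam mu d w
  rw [this]
  exact hT.contentSum_mul_adj hq lam _ i h hi

theorem coef_XPhi (hT : IsHeckeBasis q T) {m : ℕ} {lam mu : ℕ → ℕ}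
    (hmu : ∀ k : Fin n, rowOf mu k = if (k : ℕ) < m then 0 else 1) {A : ℕ → Multiset ℕ}
    {d : Equiv.Perm (Fin n)}
    (h0 : content (fun k : Fin n => rowOf mu k) (rowWord lam d) 0 = A 0)
    (h1 : content (fun k : Fin n => rowOf mu k) (rowWord lam d) 1 = A 1)
    (w : Equiv.Perm (Fin n)) :
    hT.coef w (XPhi T lam mu d) = if (loPos n m).val.map (rowWord lam w) = A 0 ∧
      (hiPos n m).val.map (rowWord lam w) = A 1 then 1 else 0 := by
  have e0 : ∀ f, content (fun k : Fin n => rowOf mu k) f 0 = (loPos n m).val.map f :=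
    content_eq_map fun k => by simp [hmu, mem_loPos]
  have e1 : ∀ f, content (fun k : Fin n => rowOf mu k) f 1 = (hiPos n m).val.map f :=
    content_eq_map fun k => by simp [hmu, mem_hiPos]
  have e2 : ∀ r f, content (fun k : Fin n => rowOf mu k) f (r + 2) = 0 := fun r f => by
    rw [content_eq_map (P := ∅) (fun k => by rw [hmu]; split_ifs <;> simp)]
    rfl
  rw [XPhi, hT.coef_sum_T, ← h0, ← h1, ← e0, ← e1]
  refine if_congr ?_ rfl rfl
  rw [mem_doubleCoset_iff, funext_iff]
  refine ⟨fun h => ⟨h 0, h 1⟩, fun h r => ?_⟩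
  match r with
  | 0 => exact h.1
  | 1 => exact h.2
  | r + 2 => rw [e2, e2]

/-- The expansion of the Garnir sum in terms of the images of `x_μ` under the tableau
homomorphisms. -/
theorem sum_contentSum_mul_sort (hT : IsHeckeBasis q T) (hq : q ≠ 0) {m : ℕ} (hm : m ≤ n)
    {lam mu : ℕ → ℕ} (hlam : Monotone fun k : Fin n => rowOf lam k)
    (hmu : ∀ k : Fin n, rowOf mu k = if (k : ℕ) < m then 0 else 1) (R S V : Multiset ℕ)
    {g₀ : Fin n → Fin 3} (hmono : Monotone g₀)
    (hg₀ : ∀ c, (Finset.univ.filter fun k => g₀ k = c).card = ((![R, S, V] : _) c).card)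
    (d : Multiset ℕ → Equiv.Perm (Fin n))
    (hd : ∀ U ∈ S.powerset.toFinset.filter (fun U => U.card + R.card = m),
      content (fun k : Fin n => rowOf mu k) (rowWord lam (d U)) 0 = R + U ∧
      content (fun k : Fin n => rowOf mu k) (rowWord lam (d U)) 1 = V + (S - U)) :
    ∑ g ∈ (splitWords n m).filter (fun g => g ∘ Tuple.sort g = g₀),
        contentSum T lam g₀ ![R, S, V] * T (Tuple.sort g) =
      ∑ U ∈ S.powerset.toFinset.filter (fun U => U.card + R.card = m),
        (qBinomProd q R U * qBinomProd q V (S - U) *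
          q ^ (invPairs R U + invPairs (S - U) V)) • XPhi T lam mu (d U) := by
  set B := (splitWords n m).filter (fun g => g ∘ Tuple.sort g = g₀) with hB
  have hXg := hT.contentSum_mul_adj hq lam (g₀ := g₀) ![R, S, V]
  refine hT.ext_coef fun w => ?_
  induction w using two_row_induction m with
  | step w i h him ih =>
    rw [(hT.mul_adj_eq_smul_iff hq).1 (hT.sum_sort_mul_adj hXg B
      (fun g hg => (Finset.mem_filter.1 hg).2) fun g hg => ?_), ih]
    · refine ((hT.mul_adj_eq_smul_iff hq).1 ?_ w).symm
      rw [Finset.sum_mul, Finset.smul_sum]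
      refine Finset.sum_congr rfl fun U _ => ?_
      have h1 := hmu ⟨i, Nat.lt_of_succ_lt h⟩
      have h2 := hmu ⟨i + 1, h⟩
      rw [smul_mul_assoc, hT.XPhi_mul_adj hq, smul_comm]
      simp only at h1 h2
      rw [h1, h2]
      split_ifs <;> omega
    · obtain ⟨hg1, hg2⟩ := Finset.mem_filter.1 hg
      refine Finset.mem_filter.2 ⟨mem_splitWords.2 fun k => ?_, comp_adjT_comp_sort hg2 i h⟩
      have := mem_splitWords.1 hg1 (adjT i h k)
      have hv := adjT_val i h k
      refine ⟨fun hk => this.1 ?_, fun hk => this.2 ?_⟩ <;> rw [hv] <;> split_ifs <;> omega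
  | base w hw =>
    set f := rowWord lam w with hf
    have hmonof : ∀ k l : Fin n, ((l : ℕ) < m ∨ m ≤ (k : ℕ)) → k ≤ l → f k ≤ f l := by
      intro k l hm hkl
      rcases hkl.eq_or_lt with rfl | hlt
      · exact le_rfl
      · exact hlam (hw k l hlt hm).le
    have hsum := sum_splitWords_content q hm f
      (fun k _ l hl hkl => hmonof k l (Or.inl (mem_loPos.1 hl)) hkl)
      (fun k hk l _ hkl => hmonof k l (Or.inr (mem_hiPos.1 hk)) hkl) R S V
    refine Eq.trans ?_ (hsum.trans ?_)
    rotate_left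
    · rw [map_sum]
      refine Finset.sum_congr rfl fun U hU => ?_
      rw [map_smul, smul_eq_mul, hT.coef_XPhi hmu (A := rows2 (R + U) (V + (S - U)))
        (hd U hU).1 (hd U hU).2]
      rfl
    rw [map_sum, hB, Finset.sum_filter]
    refine Finset.sum_congr rfl fun g hg => ?_
    by_cases hgs : g ∘ Tuple.sort g = g₀
    · rw [if_pos hgs, hT.coef_mul_T, contentSum, hT.coef_sum_T, rowWord_mul, ← hf]
      · have hc : content g₀ (f ∘ Tuple.sort g) = content g f := by
          rw [← hgs, content_comp_comp]
        rw [hc, mul_ite, mul_one, mul_zero]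
        congr
      · intro k l hkl hlt
        rw [sort_inv_lt_iff] at hlt
        have hgt : g l < g k := hlt.resolve_right fun h => hkl.not_gt h.2
        refine hw k l hkl ?_
        by_contra hcon
        have h1 := (mem_splitWords.1 hg k).1 (by omega)
        have h2 := (mem_splitWords.1 hg l).2 (by omega)
        omega
    · rw [if_neg hgs, if_neg fun h => hgs (comp_sort_eq_of_content hmono hg₀ h)]

end IsHeckeBasis

end TwoRow

theorem exists_block_word {r s t n : ℕ} (hn : r + s + t = n) : ∃ g : Fin n → Fin 3,
    Monotone g ∧ ∀ c, (Finset.univ.filter fun k => g k = c).card = ![r, s, t] c := by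
  have hcard : ∀ (p : Fin n → Prop) [DecidablePred p] (a b : ℕ), b ≤ n →
      (∀ k, p k ↔ a ≤ (k : ℕ) ∧ (k : ℕ) < b) → (Finset.univ.filter p).card = b - a := by
    intro p _ a b hb h
    rw [← Nat.card_Ico, ← Finset.card_map Fin.valEmbedding]
    congr 1
    ext x
    simp only [Finset.mem_map, Finset.mem_filter, Finset.mem_univ, true_and, h,
      Fin.valEmbedding_apply, Finset.mem_Ico]
    exact ⟨by rintro ⟨k, hk, rfl⟩; exact hk, fun hx => ⟨⟨x, by omega⟩, hx, rfl⟩⟩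
  refine ⟨fun k => if (k : ℕ) < r then 0 else if (k : ℕ) < r + s then 1 else 2, ?_, fun c => ?_⟩
  · intro k l hkl
    have : (k : ℕ) ≤ l := hkl
    dsimp only
    split_ifs <;> omega
  · have h3 : ∀ k : ℕ, k < n → ∀ c : Fin 3,
        (if k < r then 0 else if k < r + s then 1 else 2) = c ↔
          (c = 0 ∧ k < r) ∨ (c = 1 ∧ r ≤ k ∧ k < r + s) ∨ (c = 2 ∧ r + s ≤ k) := by
      intro k hk c
      split_ifs <;> omega
    fin_cases c
    · refine (hcard _ 0 r (by omega) fun k => (h3 k k.2 0).trans ?_).trans rfl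
      simp
    · refine (hcard _ r (r + s) (by omega) fun k => (h3 k k.2 1).trans ?_).trans
        (Nat.add_sub_cancel_left _ _)
      simp
    · refine (hcard _ (r + s) n le_rfl fun k => (h3 k k.2 2).trans ?_).trans
        (Nat.sub_eq_of_eq_add (by rw [add_comm, ← hn]; rfl))
      simp

/-- Theorem: the two-row Garnir-type relation.
`μ = (m, n-m) ⊢ n`; `R, S, T` multisets with `|R|+|S|+|T| = n`, `|R| ≤ m`, `|S| > m`;
`𝒮` consists of pairs `(U, V)` with `S = U ⊔ V`, `|U| = m - |R|` (encoded by the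
sub-multiset `U` of `S`, with `V = S - U`); `A[U,V]` has rows `R ⊔ U` and `T ⊔ V`,
each of type `λ` where `λ_i = R_i + S_i + T_i`.  Then
`∑_{(U,V) ∈ 𝒮} (∏_i [R_i+U_i, R_i] [T_i+V_i, T_i]) (∏_{i<j} q^{R_j U_i + T_i V_j}) φ̂_{A[U,V]} = 0`
as homomorphisms `S^μ → M^λ` (the maps `φ U` are the tableau homomorphisms
`φ_{A[U,V]} : M^μ → M^λ ⊆ H`, and the conclusion is their vanishing on `S^μ`). -/
theorem garnir_two_row
    {F : Type*} [Field F] {H : Type*} [Ring H] [Algebra F H]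
    {n m : ℕ} (hn : 1 ≤ n) (hmn : m ≤ n) (hmm : n - m ≤ m)
    (q : F) (hq : q ≠ 0)
    (T : Equiv.Perm (Fin n) → H) (hT : IsHeckeBasis q T)
    (R S Tt : Multiset ℕ)
    (hcard : R.card + S.card + Tt.card = n) (hR : R.card ≤ m) (hS : m < S.card)
    (mu : ℕ → ℕ) (hmu : mu = comp2 m (n - m))
    (lam : ℕ → ℕ) (hlam : ∀ v, lam v = R.count v + S.count v + Tt.count v)
    (wmu : Equiv.Perm (Fin n)) (hwmu : IsWmu mu wmu)
    (d : Multiset ℕ → Equiv.Perm (Fin n))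
    (hd : ∀ U ∈ S.powerset.toFinset.filter (fun U => U.card + R.card = m),
      Is1A mu lam (rows2 (R + U) (Tt + (S - U))) (d U))
    (Mmu : Submodule Hᵐᵒᵖ H) (hMmu : Mmu = Submodule.span Hᵐᵒᵖ {xElt T mu})
    (Smu : Submodule Hᵐᵒᵖ H)
    (hSmu : Smu = Submodule.span Hᵐᵒᵖ {xElt T mu * (T wmu * yElt q T (conjP mu))})
    (hle : Smu ≤ Mmu) (hxmem : xElt T mu ∈ Mmu)
    (φ : Multiset ℕ → (Mmu →ₗ[Hᵐᵒᵖ] H))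
    (hφ : ∀ U ∈ S.powerset.toFinset.filter (fun U => U.card + R.card = m),
      φ U ⟨xElt T mu, hxmem⟩ = XPhi T lam mu (d U)) :
    ∀ (z : H) (hz : z ∈ Smu),
      ∑ U ∈ S.powerset.toFinset.filter (fun U => U.card + R.card = m),
        (qBinomProd q R U * qBinomProd q Tt (S - U) *
          q ^ (invPairs R U + invPairs (S - U) Tt)) • (φ U ⟨z, hle hz⟩) = 0 := by
  subst hmu
  set B := S.powerset.toFinset.filter (fun U => U.card + R.card = m) with hB
  have hmu : ∀ k : Fin n, rowOf (comp2 m (n - m)) k = if (k : ℕ) < m then 0 else 1 := fun k =>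
    rowOf_comp2 (by omega)
  have hmono : Monotone fun k : Fin n => rowOf lam k := by
    obtain ⟨N, hN⟩ := exists_card_lt_cumSum (lam := lam) (A := R + S + Tt) fun v => by
      rw [hlam, Multiset.count_add, Multiset.count_add]
    rw [Multiset.card_add, Multiset.card_add, hcard] at hN
    exact fun k l hkl => rowOf_mono hkl (l.2.trans_eq hN.symm)
  have hcum1 : cumSum (comp2 m (n - m)) 1 = m := by simp [cumSum, comp2]
  have hcum2 : cumSum (comp2 m (n - m)) 2 = n := by
    simp [cumSum, Finset.sum_range_succ, comp2]
    omega
  have hcontent : ∀ U ∈ B,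
      content (fun k : Fin n => rowOf (comp2 m (n - m)) k) (rowWord lam (d U)) 0 = R + U ∧
      content (fun k : Fin n => rowOf (comp2 m (n - m)) k) (rowWord lam (d U)) 1 =
        Tt + (S - U) := by
    intro U hU
    obtain ⟨hUS, hUm⟩ := Finset.mem_filter.1 hU
    rw [Multiset.mem_toFinset, Multiset.mem_powerset] at hUS
    have hsub := Multiset.card_sub hUS
    have hUS' := Multiset.card_le_card hUS
    refine ⟨content_rowWord_eq (hd U hU) (r := 0) ?_ hcum2 (hcum1.trans_le hmn),
      content_rowWord_eq (hd U hU) (r := 1) ?_ hcum2 hcum2.le⟩ <;>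
    simp [rows2, comp2] <;> omega
  obtain ⟨g₀, hg₀mono, hg₀⟩ := exists_block_word hcard
  have hg₀' : ∀ c, (Finset.univ.filter fun k => g₀ k = c).card = ((![R, S, Tt] : _) c).card := by
    intro c
    rw [hg₀]
    fin_cases c <;> rfl
  have hvanish := hT.mul_mul_yElt_eq_zero hq
    (hT.contentSum_mul_adj hq lam (g₀ := g₀) ![R, S, Tt]) hg₀mono
    (kap := conjP (comp2 m (n - m))) fun g hg => by
      have hcard1 : (Finset.univ.filter fun k => g k = 1).card = S.card := by
        rw [← show _ = S.card from hg₀' 1, ← hg]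
        refine (Finset.card_equiv (Tuple.sort g) fun k => ?_).symm
        simp
      obtain ⟨i, h, hi, h1, h2⟩ := exists_adjacent_of_card_lt hmm (Nat.add_sub_cancel' hmn)
        (Finset.univ.filter fun k => g k = 1) (hcard1.symm ▸ hS)
      exact ⟨i, h, hi, (Finset.mem_filter.1 h1).2.trans (Finset.mem_filter.1 h2).2.symm⟩
  intro z hz
  obtain ⟨a, ha⟩ := Submodule.mem_span_singleton.1 (hSmu ▸ hz)
  set y := yElt q T (conjP (comp2 m (n - m))) with hy
  set c := T wmu * y * a.unop with hc
  have hza : z = xElt T (comp2 m (n - m)) * c := by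
    rw [← ha, hc]
    simp only [MulOpposite.smul_eq_mul_unop, mul_assoc]
  have hφz : ∀ U ∈ B, φ U ⟨z, hle hz⟩ = XPhi T lam (comp2 m (n - m)) (d U) * c := by
    intro U hU
    rw [← hφ U hU, show (⟨z, hle hz⟩ : Mmu) = MulOpposite.op c •
      (⟨xElt T (comp2 m (n - m)), hxmem⟩ : Mmu) from Subtype.ext hza, map_smul]
    rfl
  rw [Finset.sum_congr rfl fun U hU => by rw [hφz U hU, ← smul_mul_assoc], ← Finset.sum_mul,
    ← hT.sum_contentSum_mul_sort hq hmn hmono hmu R S Tt hg₀mono hg₀' d hcontent, Finset.sum_mul]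
  refine Finset.sum_eq_zero fun g _ => ?_
  rw [hc, ← mul_assoc, ← mul_assoc, mul_assoc _ _ (T wmu), hvanish, zero_mul]

end FayersSemistd
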